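/- arXiv:1801.07034 — 3 statements merged into one kernel-verified Lean document; each statement's English description precedes it below -/
import Mathlib

section
/- For every integer p ≥ 1 one has κ_{p,1} ≥ p · C(a(b+1), p+1), where C denotes the binomial coefficient. (This lower bound comes from the syzygies of the rational normal scroll P^1 × P^b ⊂ P^{N−1} containing the Segre–Veronese surface.) -/
open MvPolynomial
open scoped TensorProduct

set_option maxHeartbeats 1600000
set_option synthInstance.maxHeartbeats 400000
set_option maxSynthPendingDepth 3

noncomputable section

/-- The space of bihomogeneous polynomials in `k[x,y,z,w]` of bidegree `(d, e)`:
all monomials `x^α y^β z^γ w^δ` occurring satisfy `α + β = d` and `γ + δ = e`. -/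
def Bihom (k : Type*) [Field k] (d e : ℕ) : Submodule k (MvPolynomial (Fin 4) k) where
  carrier := {f | ∀ m ∈ f.support, m 0 + m 1 = d ∧ m 2 + m 3 = e}
  add_mem' := by
    intro f g hf hg m hm
    rcases Finset.mem_union.mp (MvPolynomial.support_add hm) with h | h
    exacts [hf m h, hg m h]
  zero_mem' := by intro m hm; simp at hm
  smul_mem' := by
    intro c f hf m hm
    exact hf m (MvPolynomial.support_smul hm)

/-- `RS k a b q` is the degree-`q` part `R_q` of the homogeneous coordinate ring of the
Segre–Veronese embedding of `ℙ¹×ℙ¹` by `O(a)⊠O(b)`: bihomogeneous polynomials of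
bidegree `(q*a, q*b)`. -/
abbrev RS (k : Type*) [Field k] (a b q : ℕ) : Submodule k (MvPolynomial (Fin 4) k) :=
  Bihom k (q*a) (q*b)

theorem Bihom.mul_mem' {k : Type*} [Field k] {d e d' e' : ℕ} {f g : MvPolynomial (Fin 4) k}
    (hf : f ∈ Bihom k d e) (hg : g ∈ Bihom k d' e') : f * g ∈ Bihom k (d+d') (e+e') := by
  intro m hm
  have h := MvPolynomial.support_mul f g hm
  rw [Finset.mem_add] at h
  obtain ⟨m1, h1, m2, h2, rfl⟩ := h
  obtain ⟨e1, e2⟩ := hf m1 h1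
  obtain ⟨e3, e4⟩ := hg m2 h2
  constructor <;> simp only [Finsupp.add_apply] <;> omega

/-- Multiplication `R_1 × R_q → R_{q+1}`. -/
def segMul (k : Type*) [Field k] (a b q : ℕ) (v : RS k a b 1) (f : RS k a b q) :
    RS k a b (q+1) := by
  refine ⟨(v : MvPolynomial (Fin 4) k) * (f : MvPolynomial (Fin 4) k), ?_⟩
  have h := Bihom.mul_mem' v.2 f.2
  rwa [show 1*a + q*a = (q+1)*a by ring, show 1*b + q*b = (q+1)*b by ring] at h

/-- The wedge product of a family of vectors, as an element of the `n`-th exterior power. -/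
def wedge (k : Type*) [Field k] {M : Type*} [AddCommGroup M] [Module k M] (n : ℕ)
    (v : Fin n → M) : ⋀[k]^n M :=
  ⟨ExteriorAlgebra.ιMulti k n v, ExteriorAlgebra.ιMulti_range k n (Set.mem_range_self v)⟩

/-- The type of a family of Koszul differentials
`δ_{n+1,q} : Λ^{n+1} V ⊗ R_q → Λ^n V ⊗ R_{q+1}` for the Segre–Veronese ring,
where `V = R_1`. -/
abbrev KoszulMaps (k : Type*) [Field k] (a b : ℕ) :=
  ∀ n q : ℕ, ((⋀[k]^(n+1) (RS k a b 1)) ⊗[k] (RS k a b q)) →ₗ[k]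
      ((⋀[k]^n (RS k a b 1)) ⊗[k] (RS k a b (q+1)))

/-- The defining property of the Koszul differentials:
`δ (v_1∧⋯∧v_p ⊗ f) = Σ_i (−1)^{i+1} v_1∧⋯∧v̂_i∧⋯∧v_p ⊗ v_i·f` (1-indexed signs). -/
def IsKoszul (k : Type*) [Field k] (a b : ℕ) (δ : KoszulMaps k a b) : Prop :=
  ∀ (n q : ℕ) (v : Fin (n+1) → RS k a b 1) (f : RS k a b q),
    δ n q (wedge k (n+1) v ⊗ₜ[k] f) =
      ∑ i : Fin (n+1), ((-1:k)^(i:ℕ)) •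
        (wedge k n (fun j => v (i.succAbove j)) ⊗ₜ[k] segMul k a b q (v i) f)

/-- `Kp1 k a b δ n` is the Koszul cohomology `K_{p,1}` for `p = n+1`:
`ker δ_{p,1} / im δ_{p+1,0}`. -/
abbrev Kp1 (k : Type*) [Field k] (a b : ℕ) (δ : KoszulMaps k a b) (n : ℕ) :=
  LinearMap.ker (δ n 1) ⧸
    Submodule.comap (LinearMap.ker (δ n 1)).subtype (LinearMap.range (δ (n+1) 0))



section ExteriorAlgebraContraction

variable {k : Type*} [Field k] {U V : Type*} [AddCommGroup U] [Module k U]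
  [AddCommGroup V] [Module k V]

/-- Contraction of the exterior algebra by a linear functional. -/
def extContract (d : Module.Dual k V) : ExteriorAlgebra k V →ₗ[k] ExteriorAlgebra k V :=
  CliffordAlgebra.contractLeft (Q := (0 : QuadraticForm k V)) d

theorem extContract_ι_mul (d : Module.Dual k V) (v : V) (x : ExteriorAlgebra k V) :
    extContract d (ExteriorAlgebra.ι k v * x) =
      d v • x - ExteriorAlgebra.ι k v * extContract d x :=
  CliffordAlgebra.contractLeft_ι_mul d v x

theorem extContract_algebraMap (d : Module.Dual k V) (r : k) :
    extContract d (algebraMap k (ExteriorAlgebra k V) r) = 0 :=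
  CliffordAlgebra.contractLeft_algebraMap _ d r

theorem extContract_self (d : Module.Dual k V) (x : ExteriorAlgebra k V) :
    extContract d (extContract d x) = 0 :=
  CliffordAlgebra.contractLeft_contractLeft d x

theorem extContract_comm (d d' : Module.Dual k V) (x : ExteriorAlgebra k V) :
    extContract d (extContract d' x) = -extContract d' (extContract d x) :=
  CliffordAlgebra.contractLeft_comm d d' x

theorem extContract_smul (c : k) (d : Module.Dual k V) (x : ExteriorAlgebra k V) :
    extContract (c • d) x = c • extContract d x := by
  simp [extContract]

theorem extContract_zero (x : ExteriorAlgebra k V) :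
    extContract (0 : Module.Dual k V) x = 0 := by
  simp [extContract]

theorem extContract_sum {I : Type*} (s : Finset I) (d : I → Module.Dual k V)
    (x : ExteriorAlgebra k V) :
    extContract (∑ i ∈ s, d i) x = ∑ i ∈ s, extContract (d i) x := by
  simp [extContract]

theorem extAlg_left_induction {P : ExteriorAlgebra k V → Prop}
    (algebraMap : ∀ r : k, P (algebraMap _ _ r))
    (add : ∀ x y, P x → P y → P (x + y))
    (ι_mul : ∀ x v, P x → P (ExteriorAlgebra.ι k v * x)) (x : ExteriorAlgebra k V) : P x :=
  CliffordAlgebra.left_induction (Q := (0 : QuadraticForm k V)) algebraMap add ι_mul x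

theorem ι_mul_mem_extPower (v : V) {n : ℕ} {x : ExteriorAlgebra k V} (hx : x ∈ ⋀[k]^n V) :
    ExteriorAlgebra.ι k v * x ∈ ⋀[k]^(n + 1) V := by
  rw [ExteriorAlgebra.exteriorPower, pow_succ']
  exact Submodule.mul_mem_mul (LinearMap.mem_range_self _ _) hx

theorem extPower_induction {P : ∀ (n : ℕ) (x : ExteriorAlgebra k V), x ∈ ⋀[k]^n V → Prop}
    (algebraMap : ∀ r : k, P 0 (algebraMap _ _ r) (Submodule.algebraMap_mem r))
    (add : ∀ n x y hx hy, P n x hx → P n y hy → P n (x + y) (add_mem hx hy))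
    (ι_mul : ∀ n x v hx, P n x hx →
      P (n + 1) (ExteriorAlgebra.ι k v * x) (ι_mul_mem_extPower v hx))
    {n : ℕ} {x : ExteriorAlgebra k V} (hx : x ∈ ⋀[k]^n V) : P n x hx := by
  induction hx using Submodule.pow_induction_on_left' with
  | algebraMap r => exact algebraMap r
  | add x y i hx hy ihx ihy => exact add i x y hx hy ihx ihy
  | mem_mul m hm i x hx ih =>
    obtain ⟨v, rfl⟩ := hm
    exact ι_mul i x v hx ih

theorem extContract_mem (d : Module.Dual k V) {n : ℕ} {x : ExteriorAlgebra k V}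
    (hx : x ∈ ⋀[k]^(n + 1) V) : extContract d x ∈ ⋀[k]^n V := by
  suffices h : ∀ m, ∀ x ∈ ⋀[k]^m V, ∀ n, m = n + 1 → extContract d x ∈ ⋀[k]^n V from
    h _ x hx n rfl
  intro m x hx
  induction hx using extPower_induction with
  | algebraMap r => intro n h; omega
  | add m x y _ _ hx hy =>
    intro n h
    rw [map_add]
    exact add_mem (hx n h) (hy n h)
  | ι_mul m x v hx ih =>
    intro n h
    obtain rfl : m = n := by omega
    rw [extContract_ι_mul]
    refine sub_mem (Submodule.smul_mem _ _ hx) ?_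
    cases m with
    | zero =>
      obtain ⟨r, rfl⟩ : ∃ r : k, algebraMap k _ r = x := by
        simpa [Submodule.mem_one] using hx
      rw [extContract_algebraMap, mul_zero]
      exact zero_mem _
    | succ m => exact ι_mul_mem_extPower v (ih m rfl)

theorem extContract_ιMulti (d : Module.Dual k V) (n : ℕ) (v : Fin (n + 1) → V) :
    extContract d (ExteriorAlgebra.ιMulti k (n + 1) v) =
      ∑ i : Fin (n + 1), ((-1 : k) ^ (i : ℕ)) •
        d (v i) • ExteriorAlgebra.ιMulti k n (fun j => v (i.succAbove j)) := by
  induction n with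
  | zero =>
    rw [ExteriorAlgebra.ιMulti_succ_apply, extContract_ι_mul]
    have : extContract d (1 : ExteriorAlgebra k V) = 0 := by
      simpa using extContract_algebraMap d (1 : k)
    simp [this]
  | succ n ih =>
    rw [ExteriorAlgebra.ιMulti_succ_apply, extContract_ι_mul, ih, Finset.mul_sum,
      Fin.sum_univ_succ (n := n + 1), sub_eq_add_neg, ← Finset.sum_neg_distrib]
    congr 1
    · simp [Matrix.vecTail, Function.comp_def]
    · refine Finset.sum_congr rfl fun i _ => ?_
      rw [ExteriorAlgebra.ιMulti_succ_apply (fun j => v (i.succ.succAbove j))]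
      simp [Matrix.vecTail, Function.comp_def, pow_succ]

/-- The algebra homomorphism `Λ(x + t y)`, with values in polynomials in `t`. -/
def pencilMap (x y : U →ₗ[k] V) :
    ExteriorAlgebra k U →ₐ[k] Polynomial (ExteriorAlgebra k V) :=
  ExteriorAlgebra.lift k
    ⟨(Polynomial.monomial 0).restrictScalars k ∘ₗ ExteriorAlgebra.ι k ∘ₗ x +
      (Polynomial.monomial 1).restrictScalars k ∘ₗ ExteriorAlgebra.ι k ∘ₗ y, fun u => by
      have h := ExteriorAlgebra.ι_add_mul_swap (R := k) (x u) (y u)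
      simp only [LinearMap.add_apply, LinearMap.comp_apply, LinearMap.restrictScalars_apply,
        mul_add, add_mul, Polynomial.monomial_mul_monomial, ExteriorAlgebra.ι_sq_zero]
      simp only [map_zero, zero_add, add_zero]
      rw [← map_add, add_comm, h, map_zero]⟩

/-- The coefficient of `t ^ r` in `Λ(x + t y)`. -/
def pencilCoeff (x y : U →ₗ[k] V) (r : ℕ) : ExteriorAlgebra k U →ₗ[k] ExteriorAlgebra k V :=
  (Polynomial.lcoeff (ExteriorAlgebra k V) r).restrictScalars k ∘ₗ (pencilMap x y).toLinearMap

theorem pencilCoeff_algebraMap_zero (x y : U →ₗ[k] V) (c : k) :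
    pencilCoeff x y 0 (algebraMap k _ c) = algebraMap k _ c := by
  simp [pencilCoeff, Polynomial.algebraMap_apply]

theorem pencilCoeff_algebraMap_succ (x y : U →ₗ[k] V) (r : ℕ) (c : k) :
    pencilCoeff x y (r + 1) (algebraMap k _ c) = 0 := by
  simp [pencilCoeff, Polynomial.algebraMap_apply]

theorem pencilCoeff_ι_mul_zero (x y : U →ₗ[k] V) (u : U) (α : ExteriorAlgebra k U) :
    pencilCoeff x y 0 (ExteriorAlgebra.ι k u * α) =
      ExteriorAlgebra.ι k (x u) * pencilCoeff x y 0 α := by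
  simp [pencilCoeff, pencilMap, add_mul, Polynomial.mul_coeff_zero]

theorem pencilCoeff_ι_mul_succ (x y : U →ₗ[k] V) (r : ℕ) (u : U) (α : ExteriorAlgebra k U) :
    pencilCoeff x y (r + 1) (ExteriorAlgebra.ι k u * α) =
      ExteriorAlgebra.ι k (x u) * pencilCoeff x y (r + 1) α +
        ExteriorAlgebra.ι k (y u) * pencilCoeff x y r α := by
  simp [pencilCoeff, pencilMap, add_mul, ← Polynomial.C_mul_X_eq_monomial, mul_assoc]

theorem pencilCoeff_mem (x y : U →ₗ[k] V) (r : ℕ) {n : ℕ} {α : ExteriorAlgebra k U}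
    (hα : α ∈ ⋀[k]^n U) : pencilCoeff x y r α ∈ ⋀[k]^n V := by
  induction hα using extPower_induction generalizing r with
  | algebraMap c =>
    cases r with
    | zero => rw [pencilCoeff_algebraMap_zero]; exact Submodule.algebraMap_mem c
    | succ r => rw [pencilCoeff_algebraMap_succ]; exact zero_mem _
  | add n α β _ _ hα hβ => rw [map_add]; exact add_mem (hα r) (hβ r)
  | ι_mul n α u _ ih =>
    cases r with
    | zero => rw [pencilCoeff_ι_mul_zero]; exact ι_mul_mem_extPower _ (ih 0)
    | succ r =>
      rw [pencilCoeff_ι_mul_succ]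
      exact add_mem (ι_mul_mem_extPower _ (ih _)) (ι_mul_mem_extPower _ (ih _))

theorem pencilCoeff_top (x y : U →ₗ[k] V) {n : ℕ} {α : ExteriorAlgebra k U}
    (hα : α ∈ ⋀[k]^n U) : pencilCoeff x y n α = ExteriorAlgebra.map y α := by
  suffices h : pencilCoeff x y n α = ExteriorAlgebra.map y α ∧
      ∀ m, n < m → pencilCoeff x y m α = 0 from h.1
  induction hα using extPower_induction with
  | algebraMap c =>
    refine ⟨by simp [pencilCoeff_algebraMap_zero], fun m hm => ?_⟩
    obtain ⟨m, rfl⟩ := Nat.exists_eq_succ_of_ne_zero hm.ne'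
    exact pencilCoeff_algebraMap_succ x y m c
  | add n α β _ _ hα hβ =>
    refine ⟨by simp [hα.1, hβ.1], fun m hm => by simp [hα.2 m hm, hβ.2 m hm]⟩
  | ι_mul n α u _ ih =>
    refine ⟨?_, fun m hm => ?_⟩
    · rw [pencilCoeff_ι_mul_succ, ih.1, ih.2 (n + 1) (by omega)]
      simp
    · obtain ⟨m, rfl⟩ := Nat.exists_eq_succ_of_ne_zero (Nat.ne_zero_of_lt hm)
      rw [pencilCoeff_ι_mul_succ, ih.2 (m + 1) (by omega), ih.2 m (by omega)]
      simp

theorem extContract_map (y : U →ₗ[k] V) (g : Module.Dual k V) (α : ExteriorAlgebra k U) :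
    extContract g (ExteriorAlgebra.map y α) = ExteriorAlgebra.map y (extContract (g ∘ₗ y) α) := by
  induction α using extAlg_left_induction with
  | algebraMap c => simp [extContract_algebraMap]
  | add α β hα hβ => simp [hα, hβ]
  | ι_mul α u ih => simp [extContract_ι_mul, ih]

theorem extContract_pencilCoeff_zero (x y : U →ₗ[k] V) (g : Module.Dual k V)
    (α : ExteriorAlgebra k U) :
    extContract g (pencilCoeff x y 0 α) = pencilCoeff x y 0 (extContract (g ∘ₗ x) α) := by
  induction α using extAlg_left_induction with
  | algebraMap c => simp [pencilCoeff_algebraMap_zero, extContract_algebraMap]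
  | add α β hα hβ => simp [hα, hβ]
  | ι_mul α u ih => simp [extContract_ι_mul, ih, pencilCoeff_ι_mul_zero]

theorem extContract_pencilCoeff_succ (x y : U →ₗ[k] V) (r : ℕ) (g : Module.Dual k V)
    (α : ExteriorAlgebra k U) :
    extContract g (pencilCoeff x y (r + 1) α) =
      pencilCoeff x y (r + 1) (extContract (g ∘ₗ x) α) +
        pencilCoeff x y r (extContract (g ∘ₗ y) α) := by
  induction α using extAlg_left_induction generalizing r with
  | algebraMap c => simp [pencilCoeff_algebraMap_succ, extContract_algebraMap]
  | add α β hα hβ => simp only [map_add, hα, hβ]; abel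
  | ι_mul α u ih =>
    cases r with
    | zero =>
      simp only [extContract_ι_mul, map_add, map_sub, map_smul, ih, pencilCoeff_ι_mul_succ,
        pencilCoeff_ι_mul_zero, extContract_pencilCoeff_zero, LinearMap.comp_apply, mul_add]
      abel
    | succ r =>
      simp only [extContract_ι_mul, map_add, map_sub, map_smul, ih, pencilCoeff_ι_mul_succ,
        LinearMap.comp_apply, mul_add]
      abel

theorem map_sub_smulRight_eq (d : Module.Dual k V) (e : V) (α : ExteriorAlgebra k V) :
    ExteriorAlgebra.map (LinearMap.id - d.smulRight e) α =
      α - ExteriorAlgebra.ι k e * extContract d α := by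
  induction α using extAlg_left_induction with
  | algebraMap c => simp [extContract_algebraMap]
  | add α β hα hβ => simp only [map_add, hα, hβ, mul_add]; abel
  | ι_mul α v ih =>
    have h := ExteriorAlgebra.ι_add_mul_swap (R := k) e v
    have h' := ExteriorAlgebra.ι_sq_zero (R := k) e
    rw [map_mul, ih, ExteriorAlgebra.map_apply_ι, extContract_ι_mul]
    simp only [LinearMap.sub_apply, LinearMap.id_apply, LinearMap.smulRight_apply, map_sub,
      map_smul, mul_sub, sub_mul, smul_mul_assoc, mul_smul_comm, ← mul_assoc, h',
      eq_neg_of_add_eq_zero_left h]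
    simp only [zero_mul, smul_zero, neg_mul]
    abel

/-- An element of positive degree all of whose contractions vanish is zero. -/
theorem eq_zero_of_extContract_basis {I : Type*} [Fintype I] (B : Module.Basis I k V) {n : ℕ}
    {α : ExteriorAlgebra k V} (hα : α ∈ ⋀[k]^(n + 1) V)
    (h : ∀ i, extContract (B.coord i) α = 0) : α = 0 := by
  classical
  have key : ∀ s : Finset I,
      ExteriorAlgebra.map (LinearMap.id - ∑ i ∈ s, (B.coord i).smulRight (B i)) α = α := by
    intro s
    induction s using Finset.induction_on with
    | empty => simp
    | insert i s hi ih =>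
      have hcomp : LinearMap.id - ∑ j ∈ insert i s, (B.coord j).smulRight (B j) =
          (LinearMap.id - ∑ j ∈ s, (B.coord j).smulRight (B j)) ∘ₗ
            (LinearMap.id - (B.coord i).smulRight (B i)) := by
        have h0 : (∑ j ∈ s, (B.coord j).smulRight (B j)) ∘ₗ (B.coord i).smulRight (B i) = 0 := by
          ext v
          simp only [LinearMap.comp_apply, LinearMap.smulRight_apply, map_smul,
            LinearMap.sum_apply, LinearMap.zero_apply]
          rw [Finset.sum_eq_zero, smul_zero]
          intro j hj
          have : i ≠ j := fun e => hi (e ▸ hj)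
          simp [this]
        rw [Finset.sum_insert hi, LinearMap.sub_comp, LinearMap.comp_sub, LinearMap.comp_sub, h0]
        simp only [LinearMap.id_comp, LinearMap.comp_id, sub_zero]
        abel
      rw [hcomp, ← ExteriorAlgebra.map_comp_map, AlgHom.comp_apply, map_sub_smulRight_eq, h i,
        mul_zero, sub_zero, ih]
  have hzero : LinearMap.id - ∑ i, (B.coord i).smulRight (B i) = (0 : V →ₗ[k] V) := by
    ext v
    simp [B.sum_repr]
  have := key Finset.univ
  rw [hzero] at this
  rw [← this]
  suffices hs : ∀ m, ∀ β ∈ ⋀[k]^m V, 0 < m →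
      ExteriorAlgebra.map (0 : V →ₗ[k] V) β = 0 from hs _ α hα n.succ_pos
  intro m β hβ
  induction hβ using extPower_induction with
  | algebraMap r => intro h; exact absurd h (lt_irrefl 0)
  | add m x y _ _ hx hy => intro h; rw [map_add, hx h, hy h, add_zero]
  | ι_mul m x v _ _ => intro _; simp

/-- Independence of the scroll syzygies modulo Koszul boundaries: `ω` plays the role of the
boundary, and the components are tested against all functionals on `V`. -/
theorem pencil_independent {J : Type*} (x y : U →ₗ[k] V) (hy : Function.Injective y)
    (g : ℕ → J → Module.Dual k V) (hg : ∀ i j, g (i + 1) j ∘ₗ x = g i j ∘ₗ y)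
    (N : ℕ) (hN : ∀ i, N ≤ i → ∀ j, g i j ∘ₗ y = 0)
    (hsep : ∀ (m : ℕ) (α : ExteriorAlgebra k U), α ∈ ⋀[k]^(m + 1) U →
      (∀ i j, extContract (g i j ∘ₗ y) α = 0) → α = 0)
    (p : ℕ) (l : ℕ → ExteriorAlgebra k U) (hl : ∀ r < p, l r ∈ ⋀[k]^(p + 1) U)
    (ω : ExteriorAlgebra k V)
    (H : ∀ f : Module.Dual k V,
      ∑ r ∈ Finset.range p, pencilCoeff x y r (extContract (f ∘ₗ y) (l r)) = extContract f ω) :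
    ∀ r < p, l r = 0 := by
  induction p generalizing l ω with
  | zero => intro r hr; omega
  | succ p ih =>
    have descent : ∀ M, (∀ i, M + 1 ≤ i → ∀ j, ∀ r < p + 1,
        extContract (g i j ∘ₗ y) (l r) = 0) →
        ∀ j, ∀ r < p + 1, extContract (g M j ∘ₗ y) (l r) = 0 := by
      intro M hM j
      have hω : extContract (g (M + 1) j) ω = 0 := by
        rw [← H]
        refine Finset.sum_eq_zero fun r hr => ?_
        rw [hM (M + 1) le_rfl j r (Finset.mem_range.1 hr), map_zero]
      set μ : ℕ → ExteriorAlgebra k U := fun r => extContract (g M j ∘ₗ y) (l r) with hμ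
      have hμmem : ∀ r < p + 1, μ r ∈ ⋀[k]^(p + 1) U := fun r hr => extContract_mem _ (hl r hr)
      have Hμ : ∀ f : Module.Dual k V,
          ∑ r ∈ Finset.range (p + 1), pencilCoeff x y r (extContract (f ∘ₗ y) (μ r)) = 0 := by
        intro f
        have h1 := congrArg (extContract (g (M + 1) j)) (H f)
        rw [extContract_comm, hω, map_zero, neg_zero, map_sum] at h1
        rw [← neg_eq_zero, ← h1, ← Finset.sum_neg_distrib]
        refine Finset.sum_congr rfl fun r hr => ?_
        have h2 : extContract (g (M + 1) j ∘ₗ y) (extContract (f ∘ₗ y) (l r)) = 0 := by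
          rw [extContract_comm, hM (M + 1) le_rfl j r (Finset.mem_range.1 hr), map_zero, neg_zero]
        have h3 : extContract (g (M + 1) j ∘ₗ x) (extContract (f ∘ₗ y) (l r)) =
            -extContract (f ∘ₗ y) (μ r) := by
          rw [hg, extContract_comm]
        cases r with
        | zero => rw [extContract_pencilCoeff_zero, h3, map_neg]
        | succ r => rw [extContract_pencilCoeff_succ, h3, h2, map_neg, map_zero, add_zero]
      have htop : ∀ f : Module.Dual k V,
          pencilCoeff x y p (extContract (f ∘ₗ y) (μ p)) =
            extContract f (ExteriorAlgebra.map y (μ p)) := fun f => by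
        rw [pencilCoeff_top x y (extContract_mem _ (hμmem p (by omega))), extContract_map]
      have hlow := ih μ (fun r hr => hμmem r (by omega)) (-ExteriorAlgebra.map y (μ p))
        fun f => by
          have := Hμ f
          rw [Finset.sum_range_succ, htop] at this
          rw [map_neg, eq_neg_of_add_eq_zero_left this]
      have hinj : Function.Injective (ExteriorAlgebra.map y) :=
        ExteriorAlgebra.map_injective_field (LinearMap.ker_eq_bot.2 hy)
      have hhigh : μ p = 0 := by
        refine hsep p _ (hμmem p (by omega)) fun i j' => hinj ?_
        have := Hμ (g i j')
        rw [Finset.sum_range_succ, htop, extContract_map, Finset.sum_eq_zero, zero_add] at this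
        · rw [this, map_zero]
        · intro r hr
          rw [hlow r (Finset.mem_range.1 hr), map_zero, map_zero]
      intro r hr
      rcases Nat.lt_succ_iff_lt_or_eq.1 hr with h | rfl
      · exact hlow r h
      · exact hhigh
    have all : ∀ D M, N ≤ M + D → ∀ i, M ≤ i → ∀ j, ∀ r < p + 1,
        extContract (g i j ∘ₗ y) (l r) = 0 := by
      intro D
      induction D with
      | zero =>
        intro M hM i hi j r _
        rw [hN i (by omega), extContract_zero]
      | succ D ihD =>
        intro M hM i hi j r hr
        rcases Nat.eq_or_lt_of_le hi with rfl | h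
        · exact descent M (ihD (M + 1) (by omega)) j r hr
        · exact ihD (M + 1) (by omega) i h j r hr
    intro r hr
    exact hsep (p + 1) (l r) (hl r hr) fun i j => all N 0 (by omega) i (Nat.zero_le i) j r hr

end ExteriorAlgebraContraction

section ScrollSyzygies

variable {k : Type*} [Field k] {U V W : Type*} [AddCommGroup U] [Module k U]
  [AddCommGroup V] [Module k V] [AddCommGroup W] [Module k W]

/-- Evaluation of the second tensor factor of `Λⁿ V ⊗ W` by a functional. -/
def tensorEval (n : ℕ) (g : Module.Dual k W) : (⋀[k]^n V) ⊗[k] W →ₗ[k] ExteriorAlgebra k V :=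
  (TensorProduct.rid k _).toLinearMap ∘ₗ TensorProduct.map (Submodule.subtype _) g

theorem tensorEval_tmul (n : ℕ) (g : Module.Dual k W) (w : ⋀[k]^n V) (f : W) :
    tensorEval n g (w ⊗ₜ[k] f) = g f • (w : ExteriorAlgebra k V) := by
  simp [tensorEval]

theorem eq_zero_of_tensorEval {n : ℕ} {z : (⋀[k]^n V) ⊗[k] W}
    (h : ∀ g : Module.Dual k W, tensorEval n g z = 0) : z = 0 := by
  classical
  set B := Module.Basis.ofVectorSpace k W
  have hcoord : ∀ (z : (⋀[k]^n V) ⊗[k] W) i,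
      (TensorProduct.equivFinsuppOfBasisRight B z i : ExteriorAlgebra k V) =
        tensorEval n (B.coord i) z := by
    intro z i
    induction z using TensorProduct.induction_on with
    | zero => simp
    | tmul w f => simp [tensorEval_tmul]
    | add z₁ z₂ h₁ h₂ => simp [h₁, h₂]
  apply (TensorProduct.equivFinsuppOfBasisRight B).injective
  rw [map_zero]
  ext i
  rw [Finsupp.zero_apply, ZeroMemClass.coe_zero, hcoord, h]

variable {I : Type*} [Fintype I] (B : Module.Basis I k U)

theorem eq_sum_smul_coord (d : Module.Dual k U) : d = ∑ c, d (B c) • B.coord c := by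
  refine B.ext fun i => ?_
  simp

theorem sum_extContract_coord_eq_zero (Q : I → Module.Dual k U)
    (hQ : ∀ c d, Q c (B d) = Q d (B c)) (α : ExteriorAlgebra k U) :
    ∑ c, extContract (Q c) (extContract (B.coord c) α) = 0 := by
  classical
  have h : ∀ c, extContract (Q c) (extContract (B.coord c) α) =
      ∑ d, Q c (B d) • extContract (B.coord d) (extContract (B.coord c) α) := fun c => by
    conv_lhs => rw [eq_sum_smul_coord B (Q c), extContract_sum]
    simp only [extContract_smul]
  simp only [h]
  rw [← Finset.sum_product']
  refine Finset.sum_involution (fun c _ => (c.2, c.1)) ?_ ?_ (by simp) (by simp)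
  · rintro ⟨c, d⟩ -
    simp only
    rw [hQ d c, extContract_comm, smul_neg, neg_add_cancel]
  · rintro ⟨c, d⟩ - hne heq
    obtain rfl : d = c := congrArg Prod.fst heq
    exact hne (by simp [extContract_self])

/-- The scroll syzygies: the coefficient of `t ^ r` in
`Σ_c Λ(x + t y)(u_c^* ⌋ α) ⊗ y u_c`, for `(u_c)` a basis of `U`. -/
def scrollSyzygy (x y : U →ₗ[k] V) (n r : ℕ) : ⋀[k]^(n + 1) U →ₗ[k] (⋀[k]^n V) ⊗[k] V :=
  ∑ c, (TensorProduct.mk k (⋀[k]^n V) V).flip (y (B c)) ∘ₗ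
    (pencilCoeff x y r ∘ₗ extContract (B.coord c)).restrict
      (fun _ hα => pencilCoeff_mem x y r (extContract_mem _ hα))

theorem tensorEval_scrollSyzygy (x y : U →ₗ[k] V) (n r : ℕ) (g : Module.Dual k V)
    (α : ⋀[k]^(n + 1) U) :
    tensorEval n g (scrollSyzygy B x y n r α) = pencilCoeff x y r (extContract (g ∘ₗ y) α) := by
  rw [eq_sum_smul_coord B (g ∘ₗ y), extContract_sum, map_sum]
  simp [scrollSyzygy, tensorEval_tmul, extContract_smul]

theorem sum_extContract_pencilCoeff_eq_zero (x y : U →ₗ[k] V) (r : ℕ) (G : I → Module.Dual k V)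
    (hx : ∀ c d, G c (x (B d)) = G d (x (B c))) (hy : ∀ c d, G c (y (B d)) = G d (y (B c)))
    (α : ExteriorAlgebra k U) :
    ∑ c, extContract (G c) (pencilCoeff x y r (extContract (B.coord c) α)) = 0 := by
  have h₁ := sum_extContract_coord_eq_zero B (fun c => G c ∘ₗ x) hx α
  have h₂ := sum_extContract_coord_eq_zero B (fun c => G c ∘ₗ y) hy α
  cases r with
  | zero => simp only [extContract_pencilCoeff_zero, ← map_sum, h₁, map_zero]
  | succ r =>
    simp only [extContract_pencilCoeff_succ, Finset.sum_add_distrib, ← map_sum, h₁, h₂, map_zero,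
      add_zero]

end ScrollSyzygies

section SegreVeronese

variable {k : Type*} [Field k] {a b : ℕ}

/-- The exponent of `x^α y^β z^γ w^δ`. -/
def quadExp (α β γ δ : ℕ) : Fin 4 →₀ ℕ := Finsupp.equivFunOnFinite.symm ![α, β, γ, δ]

theorem quadExp_inj {α β γ δ α' β' γ' δ' : ℕ} :
    quadExp α β γ δ = quadExp α' β' γ' δ' ↔ α = α' ∧ β = β' ∧ γ = γ' ∧ δ = δ' := by
  simp [quadExp]

theorem quadExp_add (α β γ δ α' β' γ' δ' : ℕ) :
    quadExp α β γ δ + quadExp α' β' γ' δ' = quadExp (α + α') (β + β') (γ + γ') (δ + δ') := by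
  ext i
  fin_cases i <;> simp [quadExp]

theorem monomial_quadExp_mem {α β γ δ d e : ℕ} (hd : α + β = d) (he : γ + δ = e) (c : k) :
    monomial (quadExp α β γ δ) c ∈ Bihom k d e := by
  intro m hm
  obtain rfl : m = quadExp α β γ δ := by simpa using support_monomial_subset hm
  exact ⟨by simpa [quadExp] using hd, by simpa [quadExp] using he⟩

instance finiteDimensional_bihom (d e : ℕ) : FiniteDimensional k (Bihom k d e) := by
  let S : Submodule k (MvPolynomial (Fin 4) k) := Submodule.span k (Set.range
    fun c : Fin (d + 1) × Fin (e + 1) => monomial (quadExp c.1 (d - c.1) c.2 (e - c.2)) (1 : k))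
  have : FiniteDimensional k S := FiniteDimensional.span_of_finite k (Set.finite_range _)
  refine Submodule.finiteDimensional_of_le (S₂ := S) fun f hf => ?_
  rw [f.as_sum]
  refine sum_mem fun m hm => ?_
  obtain ⟨h₁, h₂⟩ := hf m hm
  have hmon : monomial m (coeff m f) = coeff m f • monomial m (1 : k) := by
    rw [smul_monomial, smul_eq_mul, mul_one]
  rw [hmon]
  refine S.smul_mem _ (Submodule.subset_span
    ⟨(⟨m 0, by omega⟩, ⟨m 2, by omega⟩), ?_⟩)
  simp only
  congr 2
  ext i
  fin_cases i <;> simp [quadExp] <;> omega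

/-- Multiplication by `f ∈ R_q` as a linear map `R_1 → R_{q+1}`. -/
def segMulRight (k : Type*) [Field k] (a b q : ℕ) (f : RS k a b q) :
    RS k a b 1 →ₗ[k] RS k a b (q + 1) where
  toFun v := segMul k a b q v f
  map_add' _ _ := Subtype.ext (add_mul _ _ _)
  map_smul' _ _ := Subtype.ext (smul_mul_assoc _ _ _)

theorem tensorEval_koszul {δ : KoszulMaps k a b} (hδ : IsKoszul k a b δ) (n q : ℕ)
    (g : Module.Dual k (RS k a b (q + 1))) (w : ⋀[k]^(n + 1) (RS k a b 1)) (f : RS k a b q) :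
    tensorEval n g (δ n q (w ⊗ₜ[k] f)) = extContract (g ∘ₗ segMulRight k a b q f) w := by
  suffices h : tensorEval n g ∘ₗ δ n q ∘ₗ
      (TensorProduct.mk k (⋀[k]^(n + 1) (RS k a b 1)) (RS k a b q)).flip f =
      extContract (g ∘ₗ segMulRight k a b q f) ∘ₗ Submodule.subtype _ from LinearMap.congr_fun h w
  refine exteriorPower.linearMap_ext (AlternatingMap.ext fun v => ?_)
  have h₁ : tensorEval n g (δ n q (wedge k (n + 1) v ⊗ₜ[k] f)) =
      extContract (g ∘ₗ segMulRight k a b q f) (ExteriorAlgebra.ιMulti k (n + 1) v) := by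
    rw [hδ, extContract_ιMulti, map_sum]
    refine Finset.sum_congr rfl fun i _ => ?_
    rw [map_smul, tensorEval_tmul]
    rfl
  exact h₁

theorem tensorEval_koszul_zero {δ : KoszulMaps k a b} (hδ : IsKoszul k a b δ) (n : ℕ)
    (z : (⋀[k]^(n + 1) (RS k a b 1)) ⊗[k] (RS k a b 0)) :
    ∃ ω : ExteriorAlgebra k (RS k a b 1), ∀ g : Module.Dual k (RS k a b 1),
      tensorEval n g (δ n 0 z) = extContract g ω := by
  induction z using TensorProduct.induction_on with
  | zero => exact ⟨0, fun g => by simp⟩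
  | add z₁ z₂ h₁ h₂ =>
    obtain ⟨ω₁, h₁⟩ := h₁
    obtain ⟨ω₂, h₂⟩ := h₂
    exact ⟨ω₁ + ω₂, fun g => by rw [map_add, map_add, h₁, h₂, map_add]⟩
  | tmul w f =>
    obtain ⟨c, hc⟩ : ∃ c : k, (f : MvPolynomial (Fin 4) k) = C c := by
      refine ⟨coeff 0 (f : MvPolynomial (Fin 4) k), ?_⟩
      ext m
      rw [coeff_C]
      split_ifs with h
      · rw [h]
      · by_contra hne
        obtain ⟨h₁, h₂⟩ := f.2 m (mem_support_iff.2 hne)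
        apply h
        ext i
        fin_cases i <;> simp <;> omega
    refine ⟨c • (w : ExteriorAlgebra k (RS k a b 1)), fun g => ?_⟩
    have hmul : g ∘ₗ segMulRight k a b 0 f = c • g := by
      ext v
      have : segMulRight k a b 0 f v = c • v := Subtype.ext <| by
        change (v : MvPolynomial (Fin 4) k) * f = c • (v : MvPolynomial (Fin 4) k)
        rw [hc, mul_comm, smul_eq_C_mul]
      rw [LinearMap.comp_apply, LinearMap.smul_apply]
      exact (congrArg g this).trans (map_smul g c v)
    have := tensorEval_koszul hδ n 0 g w f
    rw [hmul, extContract_smul, ← map_smul] at this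
    exact this

/-- Multiplication by `x` from forms of bidegree `(a - 1, b)` to `R_1`, in monomial
coordinates. -/
def mulX (k : Type*) [Field k] (a b : ℕ) : (Fin a × Fin (b + 1) →₀ k) →ₗ[k] RS k a b 1 :=
  Finsupp.linearCombination k fun c =>
    ⟨monomial (quadExp (c.1 + 1) (a - 1 - c.1) c.2 (b - c.2)) 1,
      monomial_quadExp_mem (by omega) (by omega) 1⟩

/-- Multiplication by `y` from forms of bidegree `(a - 1, b)` to `R_1`, in monomial
coordinates. -/
def mulY (k : Type*) [Field k] (a b : ℕ) : (Fin a × Fin (b + 1) →₀ k) →ₗ[k] RS k a b 1 :=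
  Finsupp.linearCombination k fun c =>
    ⟨monomial (quadExp c.1 (a - c.1) c.2 (b - c.2)) 1,
      monomial_quadExp_mem (by omega) (by omega) 1⟩

/-- The coefficient of `x^i y^(a-i) z^j w^(b-j)`. -/
def coeffDual (k : Type*) [Field k] (a b i j : ℕ) : Module.Dual k (RS k a b 1) :=
  lcoeff k (quadExp i (a - i) j (b - j)) ∘ₗ Submodule.subtype _

theorem coe_mulX_single (c : Fin a × Fin (b + 1)) :
    (mulX k a b (Finsupp.single c 1) : MvPolynomial (Fin 4) k) =
      monomial (quadExp (c.1 + 1) (a - 1 - c.1) c.2 (b - c.2)) 1 := by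
  simp [mulX]

theorem coe_mulY_single (c : Fin a × Fin (b + 1)) :
    (mulY k a b (Finsupp.single c 1) : MvPolynomial (Fin 4) k) =
      monomial (quadExp c.1 (a - c.1) c.2 (b - c.2)) 1 := by
  simp [mulY]

theorem coeffDual_mulY_single (i j : ℕ) (c : Fin a × Fin (b + 1)) :
    coeffDual k a b i j (mulY k a b (Finsupp.single c 1)) =
      if (c.1 : ℕ) = i ∧ (c.2 : ℕ) = j then 1 else 0 := by
  simp only [coeffDual, LinearMap.comp_apply, Submodule.subtype_apply, coe_mulY_single,
    lcoeff_apply, coeff_monomial, quadExp_inj]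
  congr 1
  apply propext
  constructor <;> intro h <;> omega

theorem coeffDual_mulX_single (i j : ℕ) (c : Fin a × Fin (b + 1)) :
    coeffDual k a b (i + 1) j (mulX k a b (Finsupp.single c 1)) =
      if (c.1 : ℕ) = i ∧ (c.2 : ℕ) = j then 1 else 0 := by
  simp only [coeffDual, LinearMap.comp_apply, Submodule.subtype_apply, coe_mulX_single,
    lcoeff_apply, coeff_monomial, quadExp_inj]
  congr 1
  apply propext
  constructor <;> intro h <;> omega

theorem coeffDual_comp_mulX (i j : ℕ) :
    coeffDual k a b (i + 1) j ∘ₗ mulX k a b = coeffDual k a b i j ∘ₗ mulY k a b := by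
  ext c
  simp [coeffDual_mulX_single, coeffDual_mulY_single]

theorem coeffDual_comp_mulY_eq_zero (i : ℕ) (hi : a ≤ i) (j : ℕ) :
    coeffDual k a b i j ∘ₗ mulY k a b = 0 := by
  ext c
  have : (c.1 : ℕ) ≠ i := by omega
  simp [coeffDual_mulY_single, this]

theorem coeffDual_comp_mulY_eq_coord (c : Fin a × Fin (b + 1)) :
    coeffDual k a b c.1 c.2 ∘ₗ mulY k a b = Finsupp.basisSingleOne.coord c := by
  ext d
  simp [coeffDual_mulY_single, Finsupp.single_apply, Prod.ext_iff, Fin.ext_iff]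

theorem mulY_injective : Function.Injective (mulY k a b) := by
  rw [← LinearMap.ker_eq_bot, LinearMap.ker_eq_bot']
  intro u hu
  ext c
  have := LinearMap.congr_fun (coeffDual_comp_mulY_eq_coord (k := k) c) u
  rw [LinearMap.comp_apply, hu, map_zero] at this
  simpa using this.symm

/-- The scroll syzygies of the Segre–Veronese surface are Koszul cycles. -/
theorem koszul_scrollSyzygy_eq_zero {δ : KoszulMaps k a b} (hδ : IsKoszul k a b δ) (n r : ℕ)
    (α : ⋀[k]^(n + 2) (Fin a × Fin (b + 1) →₀ k)) :
    δ n 1 (scrollSyzygy Finsupp.basisSingleOne (mulX k a b) (mulY k a b) (n + 1) r α) = 0 := by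
  refine eq_zero_of_tensorEval fun g => ?_
  simp only [scrollSyzygy, LinearMap.sum_apply, map_sum, LinearMap.comp_apply,
    LinearMap.flip_apply, TensorProduct.mk_apply, tensorEval_koszul hδ]
  refine sum_extContract_pencilCoeff_eq_zero Finsupp.basisSingleOne (mulX k a b) (mulY k a b) r
    (fun c => g ∘ₗ segMulRight k a b 1 (mulY k a b (Finsupp.basisSingleOne c))) ?_ ?_ α
  · intro c d
    refine congrArg g (Subtype.ext ?_)
    simp only [Finsupp.coe_basisSingleOne]
    change (mulX k a b (Finsupp.single d 1) : MvPolynomial (Fin 4) k) *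
      (mulY k a b (Finsupp.single c 1) : MvPolynomial (Fin 4) k) =
      (mulX k a b (Finsupp.single c 1) : MvPolynomial (Fin 4) k) *
      (mulY k a b (Finsupp.single d 1) : MvPolynomial (Fin 4) k)
    simp only [coe_mulX_single, coe_mulY_single, monomial_mul, quadExp_add]
    congr 2
    congr 1 <;> omega
  · intro c d
    exact congrArg g (Subtype.ext (mul_comm _ _))

/-- The scroll syzygies as a map into the Koszul cycles. -/
def scrollCycles (δ : KoszulMaps k a b) (hδ : IsKoszul k a b δ) (n : ℕ) :
    (Fin (n + 1) → ⋀[k]^(n + 2) (Fin a × Fin (b + 1) →₀ k)) →ₗ[k] LinearMap.ker (δ n 1) :=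
  (∑ r : Fin (n + 1),
    scrollSyzygy Finsupp.basisSingleOne (mulX k a b) (mulY k a b) (n + 1) r ∘ₗ
      LinearMap.proj r).codRestrict _ fun l => by
    simp [koszul_scrollSyzygy_eq_zero hδ]

theorem scrollCycles_mkQ_injective (δ : KoszulMaps k a b) (hδ : IsKoszul k a b δ) (n : ℕ) :
    Function.Injective ((Submodule.comap (LinearMap.ker (δ n 1)).subtype
      (LinearMap.range (δ (n + 1) 0))).mkQ ∘ₗ scrollCycles δ hδ n) := by
  rw [← LinearMap.ker_eq_bot, LinearMap.ker_eq_bot']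
  intro l hl
  rw [LinearMap.comp_apply, Submodule.mkQ_apply, Submodule.Quotient.mk_eq_zero,
    Submodule.mem_comap] at hl
  obtain ⟨z, hz⟩ := hl
  obtain ⟨ω, hω⟩ := tensorEval_koszul_zero hδ (n + 1) z
  have key := pencil_independent (mulX k a b) (mulY k a b) mulY_injective (coeffDual k a b)
    coeffDual_comp_mulX a coeffDual_comp_mulY_eq_zero
    (fun m α hα h => eq_zero_of_extContract_basis Finsupp.basisSingleOne hα fun c => by
      rw [← coeffDual_comp_mulY_eq_coord]; exact h _ _)
    (n + 1) (fun r => if hr : r < n + 1 then (l ⟨r, hr⟩ : ExteriorAlgebra k _) else 0)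
    (fun r hr => by simp [hr]) ω fun f => by
      rw [← hω f, hz, ← Fin.sum_univ_eq_sum_range (fun r => pencilCoeff (mulX k a b) (mulY k a b) r
        (extContract (f ∘ₗ mulY k a b) (if hr : r < n + 1 then
          (l ⟨r, hr⟩ : ExteriorAlgebra k _) else 0)))]
      simp only [Fin.is_lt, dif_pos]
      simp [scrollCycles, tensorEval_scrollSyzygy]
  funext r
  have := key r r.2
  simpa only [Fin.is_lt, dif_pos, Fin.eta, Pi.zero_apply, ZeroMemClass.coe_eq_zero] using this

end SegreVeronese

/-- For every `p ≥ 1` (we write `p = n+1`) one has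
`κ_{p,1} ≥ p · C(a(b+1), p+1)`, the lower bound coming from the syzygies of the rational
normal scroll `ℙ¹ × ℙ^b` containing the Segre–Veronese surface (`1 ≤ a ≤ b`). -/
theorem segre_kappa_p1_ge_scroll_b (k : Type*) [Field k] (a b : ℕ)
    (ha : 1 ≤ a) (hab : a ≤ b)
    (δ : KoszulMaps k a b) (hδ : IsKoszul k a b δ) (n : ℕ) :
    (n + 1) * Nat.choose (a * (b + 1)) (n + 2) ≤ Module.finrank k (Kp1 k a b δ n) := by
  have h := LinearMap.finrank_le_finrank_of_injective (scrollCycles_mkQ_injective δ hδ n)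
  rw [Module.finrank_pi_fintype, exteriorPower.finrank_eq, Module.finrank_finsupp_self] at h
  simpa using h

end
end

section
/- For every integer h, the element x_h := Σ v_{(i_0,0)} ∧ v_{(i_1,1)} ∧ ⋯ ∧ v_{(i_{b−1},b−1)} ⊗ g_{h−i_0−⋯−i_{b−1}} of Λ^b V_A ⊗ G_{a−1} — the sum being over all tuples (i_0,…,i_{b−1}) ∈ {0,…,a}^b with 1 ≤ h − (i_0+⋯+i_{b−1}) ≤ a−1 — lies in the kernel of the map f. -/
open scoped TensorProduct

set_option maxHeartbeats 1600000
set_option synthInstance.maxHeartbeats 400000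
set_option maxSynthPendingDepth 3

noncomputable section

/-- The basis vector `g_h` of a vector space `G_m` with basis `g_1, …, g_m`;
by convention `g_h = 0` when `h` is out of range. -/
def gG (k : Type*) [Field k] (m : ℕ) (h : ℤ) : Fin m → k :=
  if H : 1 ≤ h ∧ h ≤ m then Pi.single (⟨(h - 1).toNat, by omega⟩ : Fin m) 1 else 0

/-- The basis vector `v'_P` of `V_B`, for `P` a point of `A = {0,…,a}×{0,…,b−1}`;
it is zero when `P ∉ B = {0,…,a−1}×{0,…,b−1}`. -/
def vB (k : Type*) [Field k] (a b : ℕ) (P : Fin (a + 1) × Fin b) : Fin a × Fin b → k :=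
  if h : (P.1 : ℕ) < a then Pi.single ((⟨P.1, h⟩ : Fin a), P.2) 1 else 0

/-- The basis vector `v'_{P−(1,0)}` of `V_B`, for `P` a point of `A`;
it is zero when `P − (1,0) ∉ B`. -/
def vBshift (k : Type*) [Field k] (a b : ℕ) (P : Fin (a + 1) × Fin b) : Fin a × Fin b → k :=
  if h : 1 ≤ (P.1 : ℕ) then
    Pi.single ((⟨(P.1 : ℕ) - 1, by have := P.1.isLt; omega⟩ : Fin a), P.2) 1 else 0

/-- The increasing enumeration `Fin (m−1) → Fin m` of `{0,…,m−1} \ {l}`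
(the `l`-th basis vector is omitted from a wedge product). -/
def skipAt {m : ℕ} (l : Fin m) (t : Fin (m - 1)) : Fin m :=
  ⟨if (t : ℕ) < (l : ℕ) then (t : ℕ) else (t : ℕ) + 1, by
    have := t.2; have := l.2; split <;> omega⟩

/-- The defining property of the linear map
`f : Λ^b V_A ⊗ G_{a−1} → Λ^{b−1} V_A ⊗ V_B ⊗ G_{a−2}`:
`f(v_{P_1}∧⋯∧v_{P_b} ⊗ g_h) = Σ_{l=1}^b (−1)^l v_{P_1}∧⋯∧v̂_{P_l}∧⋯∧v_{P_b} ⊗ v'_{P_l} ⊗ g_{h−1}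
  − Σ_{l=1}^b (−1)^l v_{P_1}∧⋯∧v̂_{P_l}∧⋯∧v_{P_b} ⊗ v'_{P_l−(1,0)} ⊗ g_h`,
with out-of-range basis symbols interpreted as `0`. -/
def IsTheMapF (k : Type*) [Field k] (a b : ℕ)
    (f : ((⋀[k]^b ((Fin (a + 1) × Fin b) → k)) ⊗[k] (Fin (a - 1) → k)) →ₗ[k]
      (((⋀[k]^(b - 1) ((Fin (a + 1) × Fin b) → k)) ⊗[k] (Fin a × Fin b → k)) ⊗[k]
        (Fin (a - 2) → k))) : Prop :=
  ∀ (P : Fin b → Fin (a + 1) × Fin b) (h : ℤ),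
    f (wedge k b (fun l => Pi.single (P l) 1) ⊗ₜ[k] gG k (a - 1) h) =
      ∑ l : Fin b, ((-1 : k) ^ ((l : ℕ) + 1)) •
        (((wedge k (b - 1) (fun t => Pi.single (P (skipAt l t)) 1) ⊗ₜ[k] vB k a b (P l))
            ⊗ₜ[k] gG k (a - 2) (h - 1))
          - ((wedge k (b - 1) (fun t => Pi.single (P (skipAt l t)) 1) ⊗ₜ[k] vBshift k a b (P l))
            ⊗ₜ[k] gG k (a - 2) h))

/-- The element
`x_h = Σ v_{(i_0,0)} ∧ ⋯ ∧ v_{(i_{b−1},b−1)} ⊗ g_{h−i_0−⋯−i_{b−1}}` of `Λ^b V_A ⊗ G_{a−1}`,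
the sum being over all tuples `(i_0,…,i_{b−1}) ∈ {0,…,a}^b` with
`1 ≤ h − (i_0+⋯+i_{b−1}) ≤ a−1` (this constraint is imposed by the convention `g_j = 0`
for `j` out of range). -/
def xker (k : Type*) [Field k] (a b : ℕ) (h : ℤ) :
    (⋀[k]^b ((Fin (a + 1) × Fin b) → k)) ⊗[k] (Fin (a - 1) → k) :=
  ∑ i : Fin b → Fin (a + 1),
    wedge k b (fun l => Pi.single (i l, l) 1) ⊗ₜ[k] gG k (a - 1) (h - ∑ l : Fin b, (i l : ℤ))

theorem skipAt_eq_succAbove {n : ℕ} (l : Fin (n + 1)) (t : Fin n) :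
    skipAt l t = l.succAbove t := by
  ext
  simp only [skipAt, Fin.succAbove, Fin.lt_def, Fin.val_castSucc]
  split <;> simp

/-- Shifting the first coordinate of `P` by one matches the two families of basis vectors
of `V_B`. -/
theorem vBshift_succ (k : Type*) [Field k] (a b : ℕ) (c : Fin a) (l : Fin b) :
    vBshift k a b (c.succ, l) = vB k a b (c.castSucc, l) := by
  simp [vBshift, vB]

theorem vBshift_zero (k : Type*) [Field k] (a b : ℕ) (l : Fin b) :
    vBshift k a b (0, l) = 0 := by
  simp [vBshift]

theorem vB_last (k : Type*) [Field k] (a b : ℕ) (l : Fin b) :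
    vB k a b (Fin.last a, l) = 0 := by
  simp [vB]

/-- The telescoping identity in a single coordinate. -/
theorem sum_vB_tmul_gG (k : Type*) [Field k] {M : Type*} [AddCommGroup M] [Module k M]
    (a b m : ℕ) (w : M) (l : Fin b) (h : ℤ) :
    ∑ c : Fin (a + 1), (w ⊗ₜ[k] vB k a b (c, l)) ⊗ₜ[k] gG k m (h - (c : ℤ) - 1) =
      ∑ c : Fin (a + 1), (w ⊗ₜ[k] vBshift k a b (c, l)) ⊗ₜ[k] gG k m (h - (c : ℤ)) := by
  rw [Fin.sum_univ_castSucc, Fin.sum_univ_succ]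
  simp only [vBshift_succ, vBshift_zero, vB_last, TensorProduct.tmul_zero,
    TensorProduct.zero_tmul, add_zero, zero_add]
  refine Finset.sum_congr rfl fun c _ => ?_
  rw [Fin.val_succ, Fin.val_castSucc, Nat.cast_succ, sub_sub]

/-- For every integer `h`, the element `x_h` lies in the kernel of `f`. -/
theorem xker_mem_ker (k : Type*) [Field k] (a b : ℕ) (ha : 3 ≤ a) (hab : a ≤ b)
    (f : ((⋀[k]^b ((Fin (a + 1) × Fin b) → k)) ⊗[k] (Fin (a - 1) → k)) →ₗ[k]
      (((⋀[k]^(b - 1) ((Fin (a + 1) × Fin b) → k)) ⊗[k] (Fin a × Fin b → k)) ⊗[k]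
        (Fin (a - 2) → k)))
    (hf : IsTheMapF k a b f) (h : ℤ) :
    xker k a b h ∈ LinearMap.ker f := by
  obtain ⟨n, rfl⟩ : ∃ n, b = n + 1 := ⟨b - 1, by omega⟩
  rw [LinearMap.mem_ker, xker, map_sum]
  simp only [hf (fun l => (_, l))]
  rw [Finset.sum_comm]
  refine Finset.sum_eq_zero fun l _ => ?_
  rw [← Finset.smul_sum, Finset.sum_sub_distrib]
  refine smul_eq_zero_of_right _ (sub_eq_zero.mpr ?_)
  rw [← (Fin.insertNthEquiv (fun _ => Fin (a + 1)) l).sum_comp,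
    ← (Fin.insertNthEquiv (fun _ => Fin (a + 1)) l).sum_comp,
    Fintype.sum_prod_type_right, Fintype.sum_prod_type_right]
  refine Finset.sum_congr rfl fun j _ => ?_
  have key := sum_vB_tmul_gG k a (n + 1) (a - 2)
    (wedge k n fun t => (Pi.single (j t, l.succAbove t) 1 : Fin (a + 1) × Fin (n + 1) → k))
    l (h - ∑ t, (j t : ℤ))
  have hsum (c : Fin (a + 1)) :
      h - ∑ t, (((Fin.insertNthEquiv (fun _ => Fin (a + 1)) l) (c, j) t : Fin (a + 1)) : ℤ) =
        h - ∑ t, (j t : ℤ) - (c : ℤ) := by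
    rw [Fin.sum_univ_succAbove _ l]
    simp only [Fin.insertNthEquiv_apply, Fin.insertNth_apply_same, Fin.insertNth_apply_succAbove]
    ring
  have hskip (t : Fin (n + 1 - 1)) : skipAt l t = l.succAbove t := skipAt_eq_succAbove l t
  simp only [hsum, hskip]
  simp only [Fin.insertNthEquiv_apply, Fin.insertNth_apply_same, Fin.insertNth_apply_succAbove]
  exact key

end
end

section
/- The family consisting of all the elements α_{S,j} (one for each (p+1)-element subset S of {0,…,a}×{0,…,b−1} with its fixed ordering, and each 0 ≤ j ≤ p−1) together with all the elements β_j (0 ≤ j ≤ p−1) is linearly independent in Λ^{p−1}V ⊗ S²V. -/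
open MvPolynomial
open scoped TensorProduct

set_option maxHeartbeats 1600000
set_option synthInstance.maxHeartbeats 400000
set_option maxSynthPendingDepth 3

noncomputable section

/-- `desc2 p c1 c2` is the strictly decreasing enumeration `l_1 > l_2 > ⋯ > l_{p−1}`
of the complement of `{c1, c2}` in `{0, …, p}` (for `c1 < c2`). -/
def desc2 (p : ℕ) (c1 c2 : Fin (p + 1)) (t : Fin (p - 1)) : Fin (p + 1) :=
  ⟨if p - 2 - (t : ℕ) < (c1 : ℕ) then p - 2 - (t : ℕ)
   else if p - 2 - (t : ℕ) + 1 < (c2 : ℕ) then p - 2 - (t : ℕ) + 1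
   else p - 2 - (t : ℕ) + 2, by
    have h1 := t.2; have h2 := c1.2; have h3 := c2.2
    split_ifs <;> omega⟩

/-- The element `X_u · X_v − X_{u'} · X_{v'}` of `S²V`. -/
def quadEl (k : Type*) [Field k] {σ : Type*} (u v u' v' : σ) :
    MvPolynomial.homogeneousSubmodule σ k 2 :=
  ⟨X u * X v - X u' * X v', by
    refine Submodule.sub_mem _ ?_ ?_ <;> rw [MvPolynomial.mem_homogeneousSubmodule]
    · exact (MvPolynomial.isHomogeneous_X k u).mul (MvPolynomial.isHomogeneous_X k v)
    · exact (MvPolynomial.isHomogeneous_X k u').mul (MvPolynomial.isHomogeneous_X k v')⟩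

/-- The element `α_{S,j}` of `Λ^{p−1}V ⊗ S²V` attached to an ordered `(p+1)`-tuple
`P_1, …, P_{p+1}` of points of `{0,…,a}×{0,…,b−1}` and an integer `0 ≤ j ≤ p−1`:
the sum over all `(e_1,…,e_{p−1}) ∈ {(0,0),(0,1)}^{p−1}` with `Σe_t = (0,j)` and all
decreasing sequences `p+1 ≥ l_1 > ⋯ > l_{p−1} ≥ 1` (parametrised by the missing pair
`l'_1 < l'_2`) of
`(−1)^{l_1+⋯+l_{p−1}} v_{P_{l_1}+e_1} ∧ ⋯ ∧ v_{P_{l_{p−1}}+e_{p−1}}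
  ⊗ (v_{P_{l'_1}+(0,1)}·v_{P_{l'_2}} − v_{P_{l'_1}}·v_{P_{l'_2}+(0,1)})`. -/
def alphaEl (k : Type*) [Field k] (a b p : ℕ)
    (P : Fin (p + 1) → Fin (a + 1) × Fin b) (j : ℕ) :
    (⋀[k]^(p-1) ((Fin (a + 1) × Fin (b + 1)) → k)) ⊗[k]
      (MvPolynomial.homogeneousSubmodule (Fin (a + 1) × Fin (b + 1)) k 2) :=
  ∑ e : Fin (p - 1) → Bool, ∑ c : Fin (p + 1) × Fin (p + 1),
    if (c.1 : ℕ) < (c.2 : ℕ) ∧ (∑ t, (if e t then 1 else 0)) = j then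
      ((-1 : k) ^ (∑ t : Fin (p - 1), ((desc2 p c.1 c.2 t : ℕ) + 1))) •
        (wedge k (p - 1) (fun t =>
            Pi.single ((P (desc2 p c.1 c.2 t)).1,
              if e t then (P (desc2 p c.1 c.2 t)).2.succ
                else (P (desc2 p c.1 c.2 t)).2.castSucc) 1)
          ⊗ₜ[k] quadEl k ((P c.1).1, (P c.1).2.succ) ((P c.2).1, (P c.2).2.castSucc)
              ((P c.1).1, (P c.1).2.castSucc) ((P c.2).1, (P c.2).2.succ))
    else 0

/-- The element `β_j` of `Λ^{p−1}V ⊗ S²V` attached to an enumeration `Q_1, …, Q_{p+1}` of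
the points of `{0,…,a−1}×{0,…,b}` and an integer `0 ≤ j ≤ p−1`, defined like `α_{S,j}`
but with shifts `e_t ∈ {(0,0),(1,0)}`, `Σe_t = (j,0)`, and second factor
`v_{Q_{l'_1}+(1,0)}·v_{Q_{l'_2}} − v_{Q_{l'_1}}·v_{Q_{l'_2}+(1,0)}`. -/
def betaEl (k : Type*) [Field k] (a b p : ℕ)
    (Q : Fin (p + 1) → Fin a × Fin (b + 1)) (j : ℕ) :
    (⋀[k]^(p-1) ((Fin (a + 1) × Fin (b + 1)) → k)) ⊗[k]
      (MvPolynomial.homogeneousSubmodule (Fin (a + 1) × Fin (b + 1)) k 2) :=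
  ∑ e : Fin (p - 1) → Bool, ∑ c : Fin (p + 1) × Fin (p + 1),
    if (c.1 : ℕ) < (c.2 : ℕ) ∧ (∑ t, (if e t then 1 else 0)) = j then
      ((-1 : k) ^ (∑ t : Fin (p - 1), ((desc2 p c.1 c.2 t : ℕ) + 1))) •
        (wedge k (p - 1) (fun t =>
            Pi.single ((if e t then (Q (desc2 p c.1 c.2 t)).1.succ
                else (Q (desc2 p c.1 c.2 t)).1.castSucc),
              (Q (desc2 p c.1 c.2 t)).2) 1)
          ⊗ₜ[k] quadEl k ((Q c.1).1.succ, (Q c.1).2) ((Q c.2).1.castSucc, (Q c.2).2)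
              ((Q c.1).1.castSucc, (Q c.1).2) ((Q c.2).1.succ, (Q c.2).2))
    else 0

/-- The set obtained from `R` by moving the elements of `J` one step up. -/
def shiftUp (R J : Finset ℕ) : Finset ℕ := (R \ J) ∪ J.image (· + 1)

theorem mem_shiftUp {R J : Finset ℕ} {x : ℕ} :
    x ∈ shiftUp R J ↔ (x ∈ R ∧ x ∉ J) ∨ ∃ s ∈ J, s + 1 = x := by
  simp [shiftUp]

/-- The `j + 1` largest elements of `S`. -/
def topPart (S : Finset ℕ) (j : ℕ) : Finset ℕ :=
  S.filter fun s => (S.filter (s < ·)).card ≤ j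

theorem mem_topPart {S : Finset ℕ} {j s : ℕ} :
    s ∈ topPart S j ↔ s ∈ S ∧ (S.filter (s < ·)).card ≤ j := by
  simp [topPart]

/-- The quantity, ordered lexicographically, which makes the leading terms triangular. -/
def leadKey (S : Finset ℕ) (j : ℕ) : Colex (Finset ℕ) ×ₗ ℕ :=
  toLex (toColex (topPart S j), j)

/-- `IsTermOf S j u u' A P P' J` says that the monomial with exterior part `A` and symmetric part
`{u + 1, u'}` is the one obtained from `S` by taking out `P` and `P'`, shifting `P` and shifting
the `j` elements of `J`. -/
structure IsTermOf (S : Finset ℕ) (j u u' : ℕ) (A : Finset ℕ) (P P' : ℕ) (J : Finset ℕ) :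
    Prop where
  mem_left : P ∈ S
  mem_right : P' ∈ S
  subset : J ⊆ S \ {P, P'}
  card : J.card = j
  quad : (P = u ∧ P' = u') ∨ (P + 1 = u' ∧ P' = u + 1)
  shift_eq : shiftUp (S \ {P, P'}) J = A
  succ_mem : ∀ s ∈ J, s + 1 ∈ S \ {P, P'} → s + 1 ∈ J

theorem toColex_topPart_lt {S S' : Finset ℕ} {j j' v : ℕ} (hv : v ∈ S) (hv' : v ∉ S')
    (habove : ∀ s, v < s → (s ∈ S ↔ s ∈ S')) (hcard : (S.filter (v < ·)).card ≤ j) :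
    toColex (topPart S' j') < toColex (topPart S j) := by
  have hvT : v ∈ topPart S j := mem_topPart.2 ⟨hv, hcard⟩
  have hvT' : v ∉ topPart S' j' := fun h => hv' (mem_topPart.1 h).1
  refine Finset.Colex.toColex_lt_toColex.2 ⟨fun h => hvT' (h ▸ hvT), fun s hs hs' => ?_⟩
  refine ⟨v, hvT, hvT', not_lt.1 fun hvs => hs' (mem_topPart.2 ⟨?_, ?_⟩)⟩
  · exact (habove s hvs).2 (mem_topPart.1 hs).1
  · refine le_trans (Finset.card_le_card fun x hx => ?_) hcard
    simp only [Finset.mem_filter] at hx ⊢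
    exact ⟨hx.1, hvs.trans hx.2⟩

theorem IsTermOf.eq_or_leadKey_lt {S S' : Finset ℕ} {j u u' P P' : ℕ} {T J : Finset ℕ}
    (hu : u ∈ S') (hu' : u' ∈ S') (hlt : u' < u)
    (hT : ∀ s, s ∈ T ↔ s ∈ S' ∧ u < s)
    (h : IsTermOf S j u u' (shiftUp (S' \ {u, u'}) T) P P' J) :
    (S = S' ∧ P = u ∧ P' = u' ∧ J = T) ∨ leadKey S' T.card < leadKey S j := by
  have hmem : ∀ x, ((x ∈ S ∧ x ≠ P ∧ x ≠ P') ∧ x ∉ J ∨ ∃ s ∈ J, s + 1 = x) ↔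
      ((x ∈ S' ∧ x ≠ u ∧ x ≠ u') ∧ x ∉ T ∨ ∃ s ∈ T, s + 1 = x) := fun x => by
    have := congrArg (x ∈ ·) h.shift_eq
    simpa [mem_shiftUp] using this
  have hJ : ∀ s ∈ J, s ∈ S ∧ s ≠ P ∧ s ≠ P' := fun s hs => by simpa using h.subset hs
  have hsucc : ∀ s ∈ J, s + 1 ∈ S → s + 1 ≠ P → s + 1 ≠ P' → s + 1 ∈ J := fun s hs h1 h2 h3 =>
    h.succ_mem s hs (by simp [h1, h2, h3])
  have hquad := h.quad
  have hP := h.mem_left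
  have hP' := h.mem_right
  -- the elements of `S` above `u` and outside `P'`
  have habove : ∀ s ∈ S, u < s → s ≠ P' → s ∈ J ∧ s ∈ T ∨ s ∉ J ∧ ∃ w ∈ T, w ∉ J ∧ w + 1 = s := by
    intro s hs hus hsP'
    by_cases hsJ : s ∈ J
    · rcases (hmem (s + 1)).1 (Or.inr ⟨s, hsJ, rfl⟩) with h1 | ⟨w, hw, hws⟩
      · exact absurd ((hT _).2 ⟨h1.1.1, by omega⟩) h1.2
      · obtain rfl : w = s := by omega
        exact Or.inl ⟨hsJ, hw⟩
    · refine Or.inr ⟨hsJ, ?_⟩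
      rcases (hmem s).1 (Or.inl ⟨⟨hs, by omega, hsP'⟩, hsJ⟩) with h1 | ⟨w, hw, rfl⟩
      · exact absurd ((hT _).2 ⟨h1.1.1, hus⟩) h1.2
      · exact ⟨w, hw, fun hwJ => hsJ (hsucc w hwJ hs (by omega) hsP'), rfl⟩
  have hmoved : ∀ w ∈ T, w ∉ J → w + 1 ∈ S ∧ w + 1 ≠ P ∧ w + 1 ≠ P' ∧ w + 1 ∉ J := by
    intro w hw hwJ
    rcases (hmem (w + 1)).2 (Or.inr ⟨w, hw, rfl⟩) with h1 | ⟨t, ht, hts⟩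
    · exact ⟨h1.1.1, h1.1.2.1, h1.1.2.2, h1.2⟩
    · obtain rfl : t = w := by omega
      exact absurd ht hwJ
  have hkey : ∀ v ∈ S, v ∉ S' → u < v → (∀ s, v < s → (s ∈ S ↔ s ∈ S')) →
      (∀ s ∈ T, v < s → s ∈ J) → leadKey S' T.card < leadKey S j := by
    intro v hv hv' huv hvs hTJ
    refine Prod.Lex.toLex_lt_toLex.2 (Or.inl (toColex_topPart_lt hv hv' hvs ?_))
    rw [← h.card]
    refine Finset.card_le_card fun s hs => ?_
    simp only [Finset.mem_filter] at hs
    exact hTJ s ((hT s).2 ⟨(hvs s hs.2).1 hs.1, huv.trans hs.2⟩) hs.2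
  by_cases hne : (T \ J).Nonempty
  · right
    set w := (T \ J).max' hne with hw_def
    have hw := (T \ J).max'_mem hne
    rw [← hw_def, Finset.mem_sdiff] at hw
    have hmax : ∀ s ∈ T, w < s → s ∈ J := fun s hs hws => by
      by_contra hsJ
      exact absurd ((T \ J).le_max' s (by simp [hs, hsJ])) (by omega)
    have huw := (hT w).1 hw.1
    obtain ⟨h1, h2, h3, h4⟩ := hmoved w hw.1 hw.2
    refine hkey (w + 1) h1 (fun h5 => h4 (hmax _ ((hT _).2 ⟨h5, by omega⟩) (by omega))) (by omega)
      (fun s hs => ⟨fun hsS => ?_, fun hsS => ?_⟩) (fun s hs hws => hmax s hs (by omega))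
    · rcases habove s hsS (by omega) (by omega) with h6 | ⟨-, t, ht, htJ, rfl⟩
      · exact ((hT s).1 h6.2).1
      · exact absurd (hmax t ht (by omega)) htJ
    · exact (hJ s (hmax s ((hT s).2 ⟨hsS, by omega⟩) (by omega))).1
  · have hTJ : ∀ s ∈ T, s ∈ J := fun s hs => by
      by_contra hsJ
      exact hne ⟨s, by simp [hs, hsJ]⟩
    rcases hquad with ⟨rfl, rfl⟩ | ⟨hPu, hPu'⟩
    · have hge : ∀ s, P ≤ s → (s ∈ S ↔ s ∈ S') := by
        intro s hs
        rcases hs.eq_or_lt with rfl | hs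
        · simp [hP, hu]
        · refine ⟨fun hsS => ?_, fun hsS => (hJ s (hTJ s ((hT s).2 ⟨hsS, hs⟩))).1⟩
          rcases habove s hsS hs (by omega) with h6 | ⟨-, t, ht, htJ, rfl⟩
          · exact ((hT s).1 h6.2).1
          · exact absurd (hTJ t ht) htJ
      rcases (Finset.card_le_card hTJ).eq_or_lt with hc | hc
      · left
        obtain rfl : T = J := Finset.eq_of_subset_of_card_le hTJ hc.ge
        refine ⟨?_, rfl, rfl, rfl⟩
        ext x
        by_cases hx : P ≤ x
        · exact hge x hx
        · by_cases hx' : x = P'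
          · simp [hx', hP', hu']
          · have hxT : x ∉ T := fun h1 => hx ((hT x).1 h1).2.le
            have hxT' : ∀ s ∈ T, s + 1 ≠ x := fun s hs h1 => by
              have := ((hT s).1 hs).2
              omega
            have := hmem x
            have hxP : x ≠ P := by omega
            simpa [hxT, hx', hxP, show ¬ ∃ s ∈ T, s + 1 = x by simpa using hxT'] using this
      · right
        rw [h.card] at hc
        have hsub : topPart S' T.card ⊆ topPart S j := by
          intro s hs
          rw [mem_topPart] at hs ⊢
          have hPs : P ≤ s := by
            by_contra hlt'
            have : insert P T ⊆ S'.filter (s < ·) := by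
              intro x hx
              simp only [Finset.mem_insert, Finset.mem_filter] at hx ⊢
              rcases hx with rfl | hx
              · exact ⟨hu, by omega⟩
              · exact ⟨((hT x).1 hx).1, by have := ((hT x).1 hx).2; omega⟩
            have h1 := Finset.card_le_card this
            rw [Finset.card_insert_of_notMem (fun h2 => by simpa using ((hT P).1 h2).2)] at h1
            omega
          refine ⟨(hge s hPs).2 hs.1, le_trans (Finset.card_le_card fun x hx => ?_)
            (hs.2.trans hc.le)⟩
          simp only [Finset.mem_filter] at hx ⊢
          exact ⟨(hge x (by omega)).1 hx.1, hx.2⟩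
        rcases (Finset.Colex.toColex_mono hsub).eq_or_lt with h1 | h1
        · exact Prod.Lex.toLex_lt_toLex.2 (Or.inr ⟨h1, hc⟩)
        · exact Prod.Lex.toLex_lt_toLex.2 (Or.inl h1)
    · right
      refine hkey P' hP' (fun h1 => ?_) (by omega) (fun s hs => ⟨fun hsS => ?_, fun hsS => ?_⟩)
        (fun s hs _ => hTJ s hs)
      · exact (hJ P' (hTJ _ ((hT _).2 ⟨h1, by omega⟩))).2.2 rfl
      · rcases habove s hsS (by omega) (by omega) with h6 | ⟨-, t, ht, htJ, rfl⟩
        · exact ((hT s).1 h6.2).1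
        · exact absurd (hTJ t ht) htJ
      · exact (hJ s (hTJ s ((hT s).2 ⟨hsS, by omega⟩))).1

theorem subset_of_shiftUp_eq {R J J' : Finset ℕ} (hJ : J ⊆ R)
    (hup : ∀ s ∈ R, ∀ t ∈ J', t < s → s ∈ J') (h : shiftUp R J = shiftUp R J') : J ⊆ J' := by
  intro s
  induction s using Nat.strong_induction_on with
  | _ s ih =>
    intro hs
    by_contra hs'
    have h1 : s ∈ shiftUp R J := h ▸ mem_shiftUp.2 (Or.inl ⟨hJ hs, hs'⟩)
    rcases mem_shiftUp.1 h1 with h2 | ⟨t, ht, rfl⟩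
    · exact h2.2 hs
    · exact hs' (hup _ (hJ hs) t (ih t (by omega) ht) (by omega))

theorem exists_upperSubset (S : Finset ℕ) :
    ∀ j ≤ S.card, ∃ J ⊆ S, J.card = j ∧ ∀ s ∈ S, ∀ t ∈ J, t < s → s ∈ J := by
  induction S using Finset.induction_on_max with
  | empty =>
    intro j hj
    exact ⟨∅, by simp, by simpa [eq_comm] using hj, by simp⟩
  | insert m S hm ih =>
    have hmS : m ∉ S := fun h => (hm m h).false
    rintro (_ | j) hj
    · exact ⟨∅, by simp, by simp, by simp⟩
    · rw [Finset.card_insert_of_notMem hmS] at hj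
      obtain ⟨J, hJS, hJ, hup⟩ := ih j (by omega)
      refine ⟨insert m J, Finset.insert_subset_insert m hJS, ?_, ?_⟩
      · rw [Finset.card_insert_of_notMem fun h => hmS (hJS h), hJ]
      · intro s hs t ht hts
        rw [Finset.mem_insert] at hs ht ⊢
        rcases hs with rfl | hs
        · exact Or.inl rfl
        · rcases ht with rfl | ht
          · exact absurd (hm s hs) (by omega)
          · exact Or.inr (hup s hs t ht hts)

theorem desc2_injective {p : ℕ} {c1 c2 : Fin (p + 1)} (h : c1 < c2) :
    Function.Injective (desc2 p c1 c2) := by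
  intro s t hst
  have h1 := congrArg Fin.val hst
  have h2 := s.2
  have h3 := t.2
  have h4 : (c1 : ℕ) < c2 := h
  ext
  simp only [desc2] at h1
  split_ifs at h1 <;> omega

theorem exists_desc2_eq_iff {p : ℕ} {c1 c2 : Fin (p + 1)} (h : c1 < c2) (l : Fin (p + 1)) :
    (∃ t, desc2 p c1 c2 t = l) ↔ l ≠ c1 ∧ l ≠ c2 := by
  have h4 : (c1 : ℕ) < c2 := h
  have h5 := c2.2
  have h6 := l.2
  constructor
  · rintro ⟨t, rfl⟩
    have h3 := t.2
    constructor <;> intro h1 <;> have h1 := congrArg Fin.val h1 <;> simp only [desc2] at h1 <;>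
      split_ifs at h1 <;> omega
  · rintro ⟨h1, h2⟩
    rw [ne_eq, Fin.ext_iff] at h1 h2
    refine ⟨⟨p - 2 - (if (l : ℕ) < c1 then (l : ℕ)
      else if (l : ℕ) < c2 then (l : ℕ) - 1 else (l : ℕ) - 2), ?_⟩, ?_⟩
    · split_ifs <;> omega
    · ext
      simp only [desc2]
      split_ifs <;> omega

/-- The common shape of `alphaEl` and `betaEl`: `x` and `y` send a point to itself and to its
shift. -/
def shiftSyzygy (k : Type*) [Field k] {U C : Type*} [Fintype C] [DecidableEq C] (x y : U → C)
    (p : ℕ) (P : Fin (p + 1) → U) (j : ℕ) :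
    (⋀[k]^(p-1) (C → k)) ⊗[k] (MvPolynomial.homogeneousSubmodule C k 2) :=
  ∑ e : Fin (p - 1) → Bool, ∑ c : Fin (p + 1) × Fin (p + 1),
    if (c.1 : ℕ) < (c.2 : ℕ) ∧ (∑ t, (if e t then 1 else 0)) = j then
      ((-1 : k) ^ (∑ t : Fin (p - 1), ((desc2 p c.1 c.2 t : ℕ) + 1))) •
        (wedge k (p - 1) (fun t => Pi.single
            (if e t then y (P (desc2 p c.1 c.2 t)) else x (P (desc2 p c.1 c.2 t))) 1)
          ⊗ₜ[k] quadEl k (y (P c.1)) (x (P c.2)) (x (P c.1)) (y (P c.2)))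
    else 0

theorem alphaEl_eq_shiftSyzygy (k : Type*) [Field k] (a b p : ℕ)
    (P : Fin (p + 1) → Fin (a + 1) × Fin b) (j : ℕ) :
    alphaEl k a b p P j =
      shiftSyzygy k (fun q => (q.1, q.2.castSucc)) (fun q => (q.1, q.2.succ)) p P j := by
  simp only [alphaEl, shiftSyzygy, apply_ite (Prod.mk _)]

theorem betaEl_eq_shiftSyzygy (k : Type*) [Field k] (a b p : ℕ)
    (Q : Fin (p + 1) → Fin a × Fin (b + 1)) (j : ℕ) :
    betaEl k a b p Q j =
      shiftSyzygy k (fun q => (q.1.castSucc, q.2)) (fun q => (q.1.succ, q.2)) p Q j := by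
  have h (t : Bool) (i i' : Fin (a + 1)) (r : Fin (b + 1)) :
      (if t then i else i', r) = if t then (i, r) else (i', r) := by cases t <;> rfl
  simp only [betaEl, shiftSyzygy, h]

/-- The coordinate functional of `Λ^n V ⊗ S²V` at `v_{A_1} ∧ ⋯ ∧ v_{A_n} ⊗ v_q v_{q'}`. -/
def monomialCoord (k : Type*) [Field k] {C : Type*} {n : ℕ} (A : Fin n → C) (q q' : C) :
    (⋀[k]^n (C → k)) ⊗[k] (MvPolynomial.homogeneousSubmodule C k 2) →ₗ[k] k :=
  LinearMap.mul' k k ∘ₗ TensorProduct.map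
    (exteriorPower.alternatingMapLinearEquiv
      (Matrix.detRowAlternating.compLinearMap (LinearMap.funLeft k k A)))
    ((MvPolynomial.lcoeff k (Finsupp.single q 1 + Finsupp.single q' 1)) ∘ₗ
      Submodule.subtype _)

theorem monomialCoord_tmul (k : Type*) [Field k] {C : Type*} {n : ℕ} (A : Fin n → C) (q q' : C)
    (v : Fin n → C → k) (f : MvPolynomial.homogeneousSubmodule C k 2) :
    monomialCoord k A q q' (wedge k n v ⊗ₜ f) =
      (Matrix.of fun i l => v i (A l)).det *
        (f : MvPolynomial C k).coeff (Finsupp.single q 1 + Finsupp.single q' 1) := by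
  have h : wedge k n v = exteriorPower.ιMulti k n v := rfl
  rw [h]
  simp only [monomialCoord, LinearMap.comp_apply, TensorProduct.map_tmul, LinearMap.mul'_apply,
    exteriorPower.alternatingMapLinearEquiv_apply_ιMulti]
  rfl

theorem det_single_ne_zero {k C : Type*} [Field k] [DecidableEq C] {n : ℕ} {A z : Fin n → C}
    (h : (Matrix.of fun i l => (Pi.single (z i) 1 : C → k) (A l)).det ≠ 0) :
    Function.Injective z ∧ Set.range z = Set.range A := by
  refine ⟨fun i i' hi => ?_, Set.Subset.antisymm ?_ ?_⟩
  · by_contra hne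
    exact h (Matrix.det_zero_of_row_eq hne (by ext l; simp [hi]))
  · rintro _ ⟨i, rfl⟩
    by_contra hz
    refine h (Matrix.det_eq_zero_of_row_eq_zero i fun l => ?_)
    simp only [Matrix.of_apply]
    exact Pi.single_eq_of_ne (fun hl => hz ⟨l, hl⟩) 1
  · rintro _ ⟨l, rfl⟩
    by_contra hz
    refine h (Matrix.det_eq_zero_of_column_eq_zero l fun i => ?_)
    simp only [Matrix.of_apply]
    exact Pi.single_eq_of_ne (fun hl => hz ⟨i, hl.symm⟩) 1

theorem det_single_self {k C : Type*} [Field k] [DecidableEq C] {n : ℕ} {z : Fin n → C}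
    (hz : Function.Injective z) :
    (Matrix.of fun i l => (Pi.single (z i) 1 : C → k) (z l)).det = 1 := by
  convert Matrix.det_one (n := Fin n) (R := k) using 2
  ext i l
  simp [Pi.single_apply, Matrix.one_apply, hz.eq_iff, eq_comm]

theorem coeff_X_mul_X {k C : Type*} [Field k] [DecidableEq C] (q q' r r' : C) :
    (X r * X r' : MvPolynomial C k).coeff (Finsupp.single q 1 + Finsupp.single q' 1) =
      if (r = q ∧ r' = q') ∨ (r = q' ∧ r' = q) then 1 else 0 := by
  have : (X r * X r' : MvPolynomial C k) =
      monomial (Finsupp.single r 1 + Finsupp.single r' 1) 1 := by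
    simp [X, monomial_mul]
  rw [this, coeff_monomial]
  refine if_congr ?_ rfl rfl
  rw [Finsupp.single_add_single_eq_single_add_single one_ne_zero one_ne_zero]
  simp

/-- The summand of `monomialCoord k A q q' (shiftSyzygy k x y p P j)` at `(e, c)`, without sign. -/
def coordTerm (k : Type*) [Field k] {U C : Type*} [DecidableEq C] (x y : U → C)
    {p : ℕ} (P : Fin (p + 1) → U) (j : ℕ) (A : Fin (p - 1) → C) (q q' : C)
    (e : Fin (p - 1) → Bool) (c : Fin (p + 1) × Fin (p + 1)) : k :=
  if (c.1 : ℕ) < (c.2 : ℕ) ∧ (∑ t, (if e t then 1 else 0)) = j then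
    (Matrix.of fun i l => (Pi.single (if e i then y (P (desc2 p c.1 c.2 i))
      else x (P (desc2 p c.1 c.2 i))) 1 : C → k) (A l)).det *
    ((if (y (P c.1) = q ∧ x (P c.2) = q') ∨ (y (P c.1) = q' ∧ x (P c.2) = q) then 1 else 0) -
      (if (x (P c.1) = q ∧ y (P c.2) = q') ∨ (x (P c.1) = q' ∧ y (P c.2) = q) then 1 else 0))
  else 0

theorem monomialCoord_shiftSyzygy (k : Type*) [Field k] {U C : Type*} [Fintype C] [DecidableEq C]
    (x y : U → C) {p : ℕ} (P : Fin (p + 1) → U) (j : ℕ) (A : Fin (p - 1) → C) (q q' : C) :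
    monomialCoord k A q q' (shiftSyzygy k x y p P j) = ∑ e, ∑ c : Fin (p + 1) × Fin (p + 1),
      (-1 : k) ^ (∑ t : Fin (p - 1), ((desc2 p c.1 c.2 t : ℕ) + 1)) *
        coordTerm k x y P j A q q' e c := by
  simp only [shiftSyzygy, map_sum]
  refine Finset.sum_congr rfl fun e _ => Finset.sum_congr rfl fun c _ => ?_
  unfold coordTerm
  by_cases h : (c.1 : ℕ) < (c.2 : ℕ) ∧ (∑ t, (if e t then 1 else 0)) = j
  · rw [if_pos h, if_pos h, map_smul, monomialCoord_tmul, smul_eq_mul]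
    simp only [quadEl, coeff_sub, coeff_X_mul_X]
  · rw [if_neg h, if_neg h, map_zero, mul_zero]

/-- The labels of the points shifted by `e`, after the indices in `c` have been left out. -/
def shiftedLabels {p : ℕ} (N : Fin (p + 1) → ℕ) (e : Fin (p - 1) → Bool)
    (c : Fin (p + 1) × Fin (p + 1)) : Finset ℕ :=
  (Finset.univ.filter fun t => e t = true).image fun t => N (desc2 p c.1 c.2 t)

theorem mem_image_sdiff_pair_iff {p : ℕ} {N : Fin (p + 1) → ℕ} (hN : Function.Injective N)
    {c : Fin (p + 1) × Fin (p + 1)} (hc : c.1 < c.2) (s : ℕ) :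
    s ∈ Finset.univ.image N \ {N c.1, N c.2} ↔ ∃ t, N (desc2 p c.1 c.2 t) = s := by
  simp only [Finset.mem_sdiff, Finset.mem_image, Finset.mem_univ, true_and, Finset.mem_insert,
    Finset.mem_singleton, not_or]
  constructor
  · rintro ⟨⟨l, rfl⟩, h1, h2⟩
    obtain ⟨t, ht⟩ := (exists_desc2_eq_iff hc l).2
      ⟨fun h => h1 (h ▸ rfl), fun h => h2 (h ▸ rfl)⟩
    exact ⟨t, ht ▸ rfl⟩
  · rintro ⟨t, rfl⟩
    obtain ⟨h1, h2⟩ := (exists_desc2_eq_iff hc _).1 ⟨t, rfl⟩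
    exact ⟨⟨_, rfl⟩, hN.ne h1, hN.ne h2⟩

theorem mem_shiftedLabels_iff {p : ℕ} {N : Fin (p + 1) → ℕ} (hN : Function.Injective N)
    (e : Fin (p - 1) → Bool) {c : Fin (p + 1) × Fin (p + 1)} (hc : c.1 < c.2) (t : Fin (p - 1)) :
    N (desc2 p c.1 c.2 t) ∈ shiftedLabels N e c ↔ e t = true := by
  simp [shiftedLabels, hN.eq_iff, (desc2_injective hc).eq_iff]

theorem card_shiftedLabels {p : ℕ} {N : Fin (p + 1) → ℕ} (hN : Function.Injective N)
    (e : Fin (p - 1) → Bool) {c : Fin (p + 1) × Fin (p + 1)} (hc : c.1 < c.2) :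
    (shiftedLabels N e c).card = ∑ t, if e t then 1 else 0 := by
  rw [shiftedLabels, Finset.card_image_of_injective _ fun s t h => desc2_injective hc (hN h),
    Finset.card_filter]

theorem shiftedLabels_subset {p : ℕ} {N : Fin (p + 1) → ℕ} (hN : Function.Injective N)
    (e : Fin (p - 1) → Bool) {c : Fin (p + 1) × Fin (p + 1)} (hc : c.1 < c.2) :
    shiftedLabels N e c ⊆ Finset.univ.image N \ {N c.1, N c.2} := by
  intro s hs
  obtain ⟨t, -, rfl⟩ := Finset.mem_image.1 hs
  exact (mem_image_sdiff_pair_iff hN hc _).2 ⟨t, rfl⟩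

section Coordinates

variable {k U C : Type*} [Field k] {x y : U → C} {ν : C → ℕ} {p : ℕ}

/-- The exterior factors of the summand of `shiftSyzygy` at `(e, c)`. -/
def shiftedPoint (x y : U → C) {p : ℕ} (P : Fin (p + 1) → U) (e : Fin (p - 1) → Bool)
    (c : Fin (p + 1) × Fin (p + 1)) (t : Fin (p - 1)) : C :=
  if e t then y (P (desc2 p c.1 c.2 t)) else x (P (desc2 p c.1 c.2 t))

theorem label_shiftedPoint (hxy : ∀ w, ν (y w) = ν (x w) + 1) (P : Fin (p + 1) → U)
    (e : Fin (p - 1) → Bool) (c : Fin (p + 1) × Fin (p + 1)) (t : Fin (p - 1)) :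
    ν (shiftedPoint x y P e c t) =
      ν (x (P (desc2 p c.1 c.2 t))) + if e t then 1 else 0 := by
  unfold shiftedPoint
  split_ifs <;> simp [hxy]

theorem image_label_shiftedPoint (hxy : ∀ w, ν (y w) = ν (x w) + 1) {P : Fin (p + 1) → U}
    (hN : Function.Injective fun l => ν (x (P l))) (e : Fin (p - 1) → Bool)
    {c : Fin (p + 1) × Fin (p + 1)} (hc : c.1 < c.2) :
    Finset.univ.image (fun t => ν (shiftedPoint x y P e c t)) =
      shiftUp (Finset.univ.image (fun l => ν (x (P l))) \ {ν (x (P c.1)), ν (x (P c.2))})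
        (shiftedLabels (fun l => ν (x (P l))) e c) := by
  have hmem := mem_shiftedLabels_iff hN e hc
  ext s
  rw [mem_shiftUp, mem_image_sdiff_pair_iff hN hc]
  simp only [Finset.mem_image, Finset.mem_univ, true_and, label_shiftedPoint hxy]
  constructor
  · rintro ⟨t, rfl⟩
    by_cases ht : e t = true
    · exact Or.inr ⟨_, (hmem t).2 ht, by simp [ht]⟩
    · exact Or.inl ⟨⟨t, by simp [ht]⟩, by simpa [ht] using hmem t⟩
  · rintro (⟨⟨t, rfl⟩, ht⟩ | ⟨_, hs, rfl⟩)
    · exact ⟨t, by simp [mt (hmem t).2 ht]⟩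
    · obtain ⟨t, ht, rfl⟩ := Finset.mem_image.1 hs
      exact ⟨t, by simp [(Finset.mem_filter.1 ht).2]⟩

variable [DecidableEq C]

theorem isTermOf_of_coordTerm_ne_zero (hxy : ∀ w, ν (y w) = ν (x w) + 1)
    {P : Fin (p + 1) → U} (hN : Function.Injective fun l => ν (x (P l))) (hν : Function.Injective ν)
    {j : ℕ} {A : Fin (p - 1) → C} {q q' : C} {u : ℕ} (hq : ν q = u + 1)
    {e : Fin (p - 1) → Bool} {c : Fin (p + 1) × Fin (p + 1)}
    (h : coordTerm k x y P j A q q' e c ≠ 0) :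
    c.1 < c.2 ∧ ∃ l l', ((l = c.1 ∧ l' = c.2) ∨ (l = c.2 ∧ l' = c.1)) ∧
      IsTermOf (Finset.univ.image fun l => ν (x (P l))) j u (ν q')
        (Finset.univ.image fun t => ν (A t)) (ν (x (P l))) (ν (x (P l')))
        (shiftedLabels (fun l => ν (x (P l))) e c) := by
  unfold coordTerm at h
  by_cases hcj : (c.1 : ℕ) < (c.2 : ℕ) ∧ (∑ t, (if e t then 1 else 0)) = j
  swap
  · exact absurd (if_neg hcj) h
  rw [if_pos hcj] at h
  have hc : c.1 < c.2 := hcj.1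
  obtain ⟨hinj, hrange⟩ := det_single_ne_zero (left_ne_zero_of_mul h)
  have hquad : ∃ l l', ((l = c.1 ∧ l' = c.2) ∨ (l = c.2 ∧ l' = c.1)) ∧
      ((y (P l) = q ∧ x (P l') = q') ∨ (y (P l) = q' ∧ x (P l') = q)) := by
    by_contra hno
    push Not at hno
    refine right_ne_zero_of_mul h ?_
    have h1 := hno c.1 c.2 (Or.inl ⟨rfl, rfl⟩)
    have h2 := hno c.2 c.1 (Or.inr ⟨rfl, rfl⟩)
    rw [if_neg (by tauto), if_neg (by tauto), sub_zero]
  obtain ⟨l, l', hl, hyx⟩ := hquad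
  have hpair : ({ν (x (P l)), ν (x (P l'))} : Finset ℕ) = {ν (x (P c.1)), ν (x (P c.2))} := by
    rcases hl with ⟨rfl, rfl⟩ | ⟨rfl, rfl⟩
    · rfl
    · exact Finset.pair_comm _ _
  refine ⟨hc, l, l', hl, by simp, by simp, hpair ▸ shiftedLabels_subset hN e hc, ?_, ?_, ?_, ?_⟩
  · rw [card_shiftedLabels hN e hc, hcj.2]
  · rcases hyx with ⟨h1, h2⟩ | ⟨h1, h2⟩
    · have := hxy (P l)
      exact Or.inl ⟨by rw [h1] at this; omega, by rw [h2]⟩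
    · exact Or.inr ⟨by rw [← hxy, h1], by rw [h2, hq]⟩
  · rw [hpair, ← image_label_shiftedPoint hxy hN e hc]
    have hrange' : Set.range (shiftedPoint x y P e c) = Set.range A := hrange
    ext s
    have := congrArg (fun R => s ∈ ν '' R) hrange'
    simpa using this
  · rw [hpair]
    intro s hs hs'
    obtain ⟨t, ht⟩ := (mem_image_sdiff_pair_iff hN hc _).1 (shiftedLabels_subset hN e hc hs)
    obtain ⟨t', ht'⟩ := (mem_image_sdiff_pair_iff hN hc _).1 hs'
    subst ht
    rw [mem_shiftedLabels_iff hN e hc] at hs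
    rw [← ht', mem_shiftedLabels_iff hN e hc]
    by_contra het
    have h1 : shiftedPoint x y P e c t = shiftedPoint x y P e c t' := by
      apply hν
      rw [label_shiftedPoint hxy, label_shiftedPoint hxy, ht']
      simp [hs, het]
    obtain rfl : t = t' := hinj h1
    exact het hs

variable [Fintype C]

theorem exists_isTermOf_of_monomialCoord_ne_zero (hxy : ∀ w, ν (y w) = ν (x w) + 1)
    {P : Fin (p + 1) → U} (hN : Function.Injective fun l => ν (x (P l))) (hν : Function.Injective ν)
    {j : ℕ} {A : Fin (p - 1) → C} {q q' : C} {u : ℕ} (hq : ν q = u + 1)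
    (h : monomialCoord k A q q' (shiftSyzygy k x y p P j) ≠ 0) :
    ∃ l l' J, IsTermOf (Finset.univ.image fun l => ν (x (P l))) j u (ν q')
      (Finset.univ.image fun t => ν (A t)) l l' J := by
  rw [monomialCoord_shiftSyzygy] at h
  obtain ⟨e, -, h⟩ := Finset.exists_ne_zero_of_sum_ne_zero h
  obtain ⟨c, -, h⟩ := Finset.exists_ne_zero_of_sum_ne_zero h
  obtain ⟨-, l, l', -, ht⟩ := isTermOf_of_coordTerm_ne_zero hxy hN hν hq (right_ne_zero_of_mul h)
  exact ⟨_, _, _, ht⟩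

theorem exists_monomialCoord_ne_zero (k : Type*) [Field k] (hxy : ∀ w, ν (y w) = ν (x w) + 1)
    {P : Fin (p + 1) → U} (hN : Function.Injective fun l => ν (x (P l))) (hν : Function.Injective ν)
    {l l' : Fin (p + 1)} (hl : l ≠ l') {J : Finset ℕ}
    (hJ : J ⊆ (Finset.univ.image fun l => ν (x (P l))) \ {ν (x (P l)), ν (x (P l'))})
    (hup : ∀ s ∈ (Finset.univ.image fun l => ν (x (P l))) \ {ν (x (P l)), ν (x (P l'))},
      ∀ t ∈ J, t < s → s ∈ J)
    (hunique : ∀ r r' J', IsTermOf (Finset.univ.image fun l => ν (x (P l))) J.card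
      (ν (x (P l))) (ν (x (P l')))
      (shiftUp ((Finset.univ.image fun l => ν (x (P l))) \ {ν (x (P l)), ν (x (P l'))}) J)
      r r' J' → r = ν (x (P l)) ∧ r' = ν (x (P l')) ∧ J' = J) :
    ∃ A : Fin (p - 1) → C,
      Finset.univ.image (fun t => ν (A t)) =
        shiftUp ((Finset.univ.image fun l => ν (x (P l))) \ {ν (x (P l)), ν (x (P l'))}) J ∧
      monomialCoord k A (y (P l)) (x (P l')) (shiftSyzygy k x y p P J.card) ≠ 0 := by
  obtain ⟨c, hc, hcl⟩ : ∃ c : Fin (p + 1) × Fin (p + 1), c.1 < c.2 ∧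
      ((l = c.1 ∧ l' = c.2) ∨ (l = c.2 ∧ l' = c.1)) := by
    rcases lt_or_gt_of_ne hl with h | h
    · exact ⟨(l, l'), h, Or.inl ⟨rfl, rfl⟩⟩
    · exact ⟨(l', l), h, Or.inr ⟨rfl, rfl⟩⟩
  have hpair : ({ν (x (P l)), ν (x (P l'))} : Finset ℕ) = {ν (x (P c.1)), ν (x (P c.2))} := by
    rcases hcl with ⟨rfl, rfl⟩ | ⟨rfl, rfl⟩
    · rfl
    · exact Finset.pair_comm _ _
  set e : Fin (p - 1) → Bool := fun t => decide (ν (x (P (desc2 p c.1 c.2 t))) ∈ J) with he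
  have hlabels : shiftedLabels (fun l => ν (x (P l))) e c = J := by
    ext s
    constructor
    · intro hs
      obtain ⟨t, ht, rfl⟩ := Finset.mem_image.1 hs
      simpa [he] using ht
    · intro hs
      obtain ⟨t, rfl⟩ := (mem_image_sdiff_pair_iff hN hc s).1 (hpair ▸ hJ hs)
      exact (mem_shiftedLabels_iff hN e hc t).2 (by simpa [he] using hs)
  have himage : Finset.univ.image (fun t => ν (shiftedPoint x y P e c t)) =
      shiftUp ((Finset.univ.image fun l => ν (x (P l))) \ {ν (x (P l)), ν (x (P l'))}) J := by
    rw [image_label_shiftedPoint hxy hN e hc, hpair, hlabels]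
  have hlt : ∀ t t', e t = true → e t' ≠ true →
      ν (shiftedPoint x y P e c t) ≠ ν (shiftedPoint x y P e c t') := by
    intro t t' ht ht' h
    rw [label_shiftedPoint hxy, label_shiftedPoint hxy, if_pos ht, if_neg ht'] at h
    refine ht' (decide_eq_true (hup _ ?_ _ (of_decide_eq_true ht) (by omega)))
    rw [hpair, mem_image_sdiff_pair_iff hN hc]
    exact ⟨t', rfl⟩
  have hinj : Function.Injective (shiftedPoint x y P e c) := by
    intro t t' h
    have h1 := congrArg ν h
    by_cases ht : e t = true <;> by_cases ht' : e t' = true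
    · rw [label_shiftedPoint hxy, label_shiftedPoint hxy, if_pos ht, if_pos ht'] at h1
      exact desc2_injective hc (hN (Nat.add_right_cancel h1))
    · exact absurd h1 (hlt t t' ht ht')
    · exact absurd h1.symm (hlt t' t ht' ht)
    · rw [label_shiftedPoint hxy, label_shiftedPoint hxy, if_neg ht, if_neg ht'] at h1
      exact desc2_injective hc (hN (Nat.add_right_cancel h1))
  refine ⟨shiftedPoint x y P e c, himage, ?_⟩
  have hzero : ∀ e' c', coordTerm k x y P J.card (shiftedPoint x y P e c) (y (P l)) (x (P l')) e' c'
      ≠ 0 → c' = c ∧ e' = e := by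
    intro e' c' h
    obtain ⟨hc', r, r', hr, ht⟩ := isTermOf_of_coordTerm_ne_zero hxy hN hν (hxy _) h
    rw [himage] at ht
    obtain ⟨h1, h2, h3⟩ := hunique _ _ _ ht
    obtain rfl := hN h1
    obtain rfl := hN h2
    obtain rfl : c' = c := by
      rcases hr with ⟨rfl, rfl⟩ | ⟨rfl, rfl⟩ <;> rcases hcl with ⟨h4, h5⟩ | ⟨h4, h5⟩
      · exact Prod.ext h4 h5
      · exact absurd hc (by rw [← h4, ← h5]; exact hc'.asymm)
      · exact absurd hc (by rw [← h4, ← h5]; exact hc'.asymm)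
      · exact Prod.ext h5 h4
    refine ⟨rfl, funext fun t => ?_⟩
    rw [Bool.eq_iff_iff, ← mem_shiftedLabels_iff hN e' hc, ← mem_shiftedLabels_iff hN e hc, h3,
      hlabels]
  rw [monomialCoord_shiftSyzygy, Finset.sum_eq_single e, Finset.sum_eq_single c]
  · refine mul_ne_zero (pow_ne_zero _ (neg_ne_zero.2 one_ne_zero)) ?_
    have hcard : (∑ t, if e t then 1 else 0) = J.card := by
      rw [← card_shiftedLabels hN e hc, hlabels]
    have hdet : (Matrix.of fun i t => (Pi.single (if e i then y (P (desc2 p c.1 c.2 i))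
        else x (P (desc2 p c.1 c.2 i))) 1 : C → k) (shiftedPoint x y P e c t)).det = 1 :=
      det_single_self hinj
    unfold coordTerm
    rw [if_pos ⟨hc, hcard⟩, hdet, one_mul]
    have hne : ν (x (P l)) ≠ ν (x (P l')) := hN.ne hl
    have hyy : y (P l) ≠ y (P l') := fun h => hne (by
      have := congrArg ν h
      rw [hxy, hxy] at this
      omega)
    have hyx : y (P l) ≠ x (P l) := fun h => by
      have := congrArg ν h
      rw [hxy] at this
      omega
    rcases hcl with ⟨h4, h5⟩ | ⟨h4, h5⟩
    · rw [← h4, ← h5, if_pos (Or.inl ⟨rfl, rfl⟩), if_neg, sub_zero]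
      · exact one_ne_zero
      · rintro (⟨h6, -⟩ | ⟨-, h6⟩)
        · exact hyx h6.symm
        · exact hyy h6.symm
    · rw [← h4, ← h5, if_neg, if_pos (Or.inr ⟨rfl, rfl⟩), zero_sub]
      · exact neg_ne_zero.2 one_ne_zero
      · rintro (⟨h6, -⟩ | ⟨-, h6⟩)
        · exact hyy h6.symm
        · exact hyx h6.symm
  · intro c' _ hc'
    by_contra h
    exact hc' (hzero e c' (right_ne_zero_of_mul h)).1
  · simp
  · intro e' _ he'
    refine Finset.sum_eq_zero fun c' _ => ?_
    by_contra h
    exact he' (hzero e' c' (right_ne_zero_of_mul h)).2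
  · simp

theorem monomialCoord_shiftSyzygy_eq_zero {q q' : C} (hq : ∀ w, y w ≠ q) (hq' : ∀ w, y w ≠ q')
    (P : Fin (p + 1) → U) (j : ℕ) (A : Fin (p - 1) → C) :
    monomialCoord k A q q' (shiftSyzygy k x y p P j) = 0 := by
  rw [monomialCoord_shiftSyzygy]
  refine Finset.sum_eq_zero fun e _ => Finset.sum_eq_zero fun c _ => ?_
  simp [coordTerm, hq, hq']

theorem exists_leading_monomialCoord (k : Type*) [Field k] (hxy : ∀ w, ν (y w) = ν (x w) + 1)
    {P : Fin (p + 1) → U} (hN : Function.Injective fun l => ν (x (P l))) (hν : Function.Injective ν)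
    {j : ℕ} (hj : j < p) :
    ∃ (A : Fin (p - 1) → C) (q q' : C), monomialCoord k A q q' (shiftSyzygy k x y p P j) ≠ 0 ∧
      ∀ (P' : Fin (p + 1) → U) (j' : ℕ), (Function.Injective fun l => ν (x (P' l))) →
        monomialCoord k A q q' (shiftSyzygy k x y p P' j') ≠ 0 →
        (Finset.univ.image (fun l => ν (x (P' l))) = Finset.univ.image (fun l => ν (x (P l))) ∧
          j' = j) ∨
        leadKey (Finset.univ.image fun l => ν (x (P l))) j <
          leadKey (Finset.univ.image fun l => ν (x (P' l))) j' := by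
  set S := Finset.univ.image fun l => ν (x (P l)) with hS
  have hcard : S.card = p + 1 := by
    rw [hS, Finset.card_image_of_injective _ hN, Finset.card_univ, Fintype.card_fin]
  obtain ⟨T₀, hT₀S, hT₀, hup⟩ := exists_upperSubset S (j + 1) (by omega)
  have hT₀ne : T₀.Nonempty := Finset.card_pos.1 (by omega)
  have huT₀ := T₀.min'_mem hT₀ne
  have hmin : ∀ s ∈ T₀, T₀.min' hT₀ne ≤ s := fun s hs => T₀.min'_le s hs
  generalize T₀.min' hT₀ne = u at huT₀ hmin
  obtain ⟨u', hu'S, hu'T₀⟩ : ∃ u' ∈ S, u' ∉ T₀ := Finset.exists_mem_notMem_of_card_lt_card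
    (by omega)
  have huS := hT₀S huT₀
  have hlt : u' < u := by
    rcases lt_trichotomy u' u with h | rfl | h
    · exact h
    · exact absurd huT₀ hu'T₀
    · exact absurd (hup u' hu'S u huT₀ h) hu'T₀
  obtain ⟨l, -, hl⟩ := Finset.mem_image.1 huS
  obtain ⟨l', -, hl'⟩ := Finset.mem_image.1 hu'S
  have hT : ∀ s, s ∈ T₀.erase u ↔ s ∈ S ∧ u < s := by
    intro s
    rw [Finset.mem_erase]
    exact ⟨fun h => ⟨hT₀S h.2, lt_of_le_of_ne (hmin s h.2) h.1.symm⟩,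
      fun h => ⟨h.2.ne', hup s h.1 u huT₀ h.2⟩⟩
  have hTcard : (T₀.erase u).card = j := by
    rw [Finset.card_erase_of_mem huT₀, hT₀]
    rfl
  have hlead : ∀ {S' j' r r' J}, IsTermOf S' j' u u' (shiftUp (S \ {u, u'}) (T₀.erase u)) r r' J →
      (S' = S ∧ r = u ∧ r' = u' ∧ J = T₀.erase u) ∨ leadKey S (T₀.erase u).card < leadKey S' j' :=
    fun h => h.eq_or_leadKey_lt huS hu'S hlt hT
  obtain ⟨A, hA, hne⟩ := exists_monomialCoord_ne_zero k hxy hN hν (l := l) (l' := l')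
    (J := T₀.erase u) (by rintro rfl; omega) (by
      rw [hl, hl', ← hS]
      intro s hs
      have h := (hT s).1 hs
      simp only [Finset.mem_sdiff, Finset.mem_insert, Finset.mem_singleton]
      exact ⟨h.1, by omega⟩) (by
      rw [← hS]
      intro s hs t ht hts
      exact (hT s).2 ⟨(Finset.mem_sdiff.1 hs).1, ((hT t).1 ht).2.trans hts⟩) (by
      rw [hl, hl', ← hS]
      intro r r' J' h
      rcases hlead h with h1 | h1
      · exact h1.2
      · exact absurd h1 (lt_irrefl _))
  rw [hl, hl', ← hS] at hA
  rw [hTcard] at hne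
  refine ⟨A, _, _, hne, fun P' j' hN' h => ?_⟩
  obtain ⟨r, r', J, ht⟩ := exists_isTermOf_of_monomialCoord_ne_zero hxy hN' hν
    (u := u) (by rw [hxy, hl]) h
  rw [hA, hl'] at ht
  rcases hlead ht with h1 | h1
  · exact Or.inl ⟨h1.1, by rw [← ht.card, h1.2.2.2, hTcard]⟩
  · exact Or.inr (hTcard ▸ h1)

theorem exists_bottom_monomialCoord (k : Type*) [Field k] (hxy : ∀ w, ν (y w) = ν (x w) + 1)
    {P : Fin (p + 1) → U} (hN : Function.Injective fun l => ν (x (P l))) (hν : Function.Injective ν)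
    {l l' : Fin (p + 1)} (hl : ν (x (P l)) = 1) (hl' : ν (x (P l')) = 0) {j : ℕ} (hj : j < p) :
    ∃ A : Fin (p - 1) → C,
      monomialCoord k A (y (P l)) (x (P l')) (shiftSyzygy k x y p P j) ≠ 0 ∧
      ∀ j', monomialCoord k A (y (P l)) (x (P l')) (shiftSyzygy k x y p P j') ≠ 0 → j' ≤ j := by
  set S := Finset.univ.image fun l => ν (x (P l)) with hS
  have hcard : S.card = p + 1 := by
    rw [hS, Finset.card_image_of_injective _ hN, Finset.card_univ, Fintype.card_fin]
  have hsub : ({1, 0} : Finset ℕ) ⊆ S := by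
    intro s hs
    rw [Finset.mem_insert, Finset.mem_singleton] at hs
    rcases hs with rfl | rfl
    · exact Finset.mem_image.2 ⟨l, Finset.mem_univ _, hl⟩
    · exact Finset.mem_image.2 ⟨l', Finset.mem_univ _, hl'⟩
  obtain ⟨T, hTS, hTcard, hup⟩ := exists_upperSubset (S \ {1, 0}) j (by
    rw [Finset.card_sdiff_of_subset hsub, hcard, Finset.card_pair one_ne_zero]
    omega)
  have hterm : ∀ {j' r r' J}, IsTermOf S j' 1 0 (shiftUp (S \ {1, 0}) T) r r' J →
      r = 1 ∧ r' = 0 ∧ J ⊆ T := by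
    intro j' r r' J h
    have hsub := h.subset
    have hshift := h.shift_eq
    obtain ⟨rfl, rfl⟩ : r = 1 ∧ r' = 0 := by
      have := h.quad
      omega
    exact ⟨rfl, rfl, subset_of_shiftUp_eq hsub hup hshift⟩
  obtain ⟨A, hA, hne⟩ := exists_monomialCoord_ne_zero k hxy hN hν (l := l) (l' := l') (J := T)
    (by rintro rfl; omega) (by rw [hl, hl']; exact hTS) (by rw [hl, hl']; exact hup) (by
      rw [hl, hl', ← hS]
      intro r r' J h
      obtain ⟨h1, h2, h3⟩ := hterm h
      exact ⟨h1, h2, Finset.eq_of_subset_of_card_le h3 h.card.ge⟩)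
  rw [hl, hl', ← hS] at hA
  rw [hTcard] at hne
  refine ⟨A, hne, fun j' h => ?_⟩
  obtain ⟨r, r', J, ht⟩ := exists_isTermOf_of_monomialCoord_ne_zero hxy hN hν
    (u := 1) (by rw [hxy, hl]) h
  rw [hA, hl'] at ht
  rw [← ht.card, ← hTcard]
  exact Finset.card_le_card (hterm ht).2.2

end Coordinates

theorem linearIndependent_of_triangular {k ι κ M : Type*} [Field k] [Fintype ι] [LinearOrder κ]
    [AddCommGroup M] [Module k M] {v : ι → M} (key : ι → κ)
    (h : ∀ i, ∃ φ : M →ₗ[k] k, φ (v i) ≠ 0 ∧ ∀ i', φ (v i') ≠ 0 → i' = i ∨ key i < key i') :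
    LinearIndependent k v := by
  classical
  rw [Fintype.linearIndependent_iff]
  intro g hg
  by_contra! hne
  obtain ⟨i₀, hi₀⟩ := hne
  obtain ⟨i, hi, hmax⟩ := Finset.exists_max_image (Finset.univ.filter fun i => g i ≠ 0) key
    ⟨i₀, by simp [hi₀]⟩
  obtain ⟨φ, hφ, hφ'⟩ := h i
  have hsum := congrArg φ hg
  rw [map_sum, map_zero, Finset.sum_eq_single i] at hsum
  · rw [map_smul, smul_eq_mul] at hsum
    exact mul_ne_zero (Finset.mem_filter.1 hi).2 hφ hsum
  · intro i' _ hne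
    rw [map_smul, smul_eq_mul]
    by_contra h0
    rcases hφ' i' (right_ne_zero_of_mul h0) with h1 | h1
    · exact hne h1
    · exact absurd (hmax i' (by simp [left_ne_zero_of_mul h0])) (not_le.2 h1)
  · simp

/-- With `3 ≤ a ≤ b` and `p = ab + a − 1`, the family consisting of all the
elements `α_{S,j}` (one for each `(p+1)`-element subset `S` of `{0,…,a}×{0,…,b−1}` with its
fixed ordering `ord S`, and each `0 ≤ j ≤ p−1`) together with all the elements `β_j`
(`0 ≤ j ≤ p−1`, for a fixed enumeration `Q` of `{0,…,a−1}×{0,…,b}`) is linearly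
independent in `Λ^{p−1}V ⊗ S²V`. -/
theorem alpha_beta_linearIndependent (k : Type*) [Field k] (a b : ℕ)
    (ha : 3 ≤ a) (hab : a ≤ b) (p : ℕ) (hp : p = a * b + a - 1)
    (ord : Finset (Fin (a + 1) × Fin b) → Fin (p + 1) → Fin (a + 1) × Fin b)
    (hord : ∀ S : Finset (Fin (a + 1) × Fin b), S.card = p + 1 →
      Function.Injective (ord S) ∧ ∀ t, ord S t ∈ S)
    (Q : Fin (p + 1) → Fin a × Fin (b + 1)) (hQ : Function.Bijective Q) :
    LinearIndependent k
      (fun idx : ({S : Finset (Fin (a + 1) × Fin b) // S.card = p + 1} × Fin p) ⊕ Fin p =>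
        match idx with
        | Sum.inl Sj => alphaEl k a b p (ord Sj.1.1) (Sj.2 : ℕ)
        | Sum.inr j => betaEl k a b p Q (j : ℕ)) := by
  set νa : Fin (a + 1) × Fin (b + 1) → ℕ := fun q => finProdFinEquiv q with hνa
  set νb : Fin (a + 1) × Fin (b + 1) → ℕ := fun q => finProdFinEquiv q.swap with hνb
  have hνa_inj : Function.Injective νa := Fin.val_injective.comp finProdFinEquiv.injective
  have hνb_inj : Function.Injective νb :=
    (Fin.val_injective.comp finProdFinEquiv.injective).comp Prod.swap_injective
  have hxya : ∀ w : Fin (a + 1) × Fin b, νa (w.1, w.2.succ) = νa (w.1, w.2.castSucc) + 1 := by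
    intro w
    simp only [hνa, finProdFinEquiv_apply_val, Fin.val_succ, Fin.val_castSucc]
    omega
  have hxyb : ∀ w : Fin a × Fin (b + 1), νb (w.1.succ, w.2) = νb (w.1.castSucc, w.2) + 1 := by
    intro w
    simp only [hνb, Prod.swap_prod_mk, finProdFinEquiv_apply_val, Fin.val_succ, Fin.val_castSucc]
    omega
  have hxa_inj : Function.Injective fun w : Fin (a + 1) × Fin b => νa (w.1, w.2.castSucc) := by
    intro w w' h
    have h1 := hνa_inj h
    rw [Prod.mk.injEq, Fin.castSucc_inj] at h1
    exact Prod.ext h1.1 h1.2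
  have hNb : Function.Injective fun l => νb ((Q l).1.castSucc, (Q l).2) := by
    intro l l' h
    have h1 := hνb_inj h
    rw [Prod.mk.injEq, Fin.castSucc_inj] at h1
    exact hQ.1 (Prod.ext h1.1 h1.2)
  have hNa : ∀ S : Finset (Fin (a + 1) × Fin b), S.card = p + 1 →
      Function.Injective fun l => νa ((ord S l).1, (ord S l).2.castSucc) :=
    fun S hS => hxa_inj.comp (hord S hS).1
  have himage : ∀ S : Finset (Fin (a + 1) × Fin b), S.card = p + 1 →
      Finset.univ.image (ord S) = S := by
    intro S hS
    refine Finset.eq_of_subset_of_card_le ?_ ?_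
    · intro w hw
      obtain ⟨t, -, rfl⟩ := Finset.mem_image.1 hw
      exact (hord S hS).2 t
    · rw [Finset.card_image_of_injective _ (hord S hS).1, hS, Finset.card_univ, Fintype.card_fin]
  have hlabels_inj : ∀ S S' : Finset (Fin (a + 1) × Fin b), S.card = p + 1 → S'.card = p + 1 →
      Finset.univ.image (fun l => νa ((ord S l).1, (ord S l).2.castSucc)) =
        Finset.univ.image (fun l => νa ((ord S' l).1, (ord S' l).2.castSucc)) → S = S' := by
    intro S S' hS hS' h
    apply Finset.image_injective hxa_inj
    rw [← himage S hS, ← himage S' hS', Finset.image_image, Finset.image_image]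
    exact h
  obtain ⟨l, hl⟩ := hQ.2 (⟨1, by omega⟩, 0)
  obtain ⟨l', hl'⟩ := hQ.2 (⟨0, by omega⟩, 0)
  have hl1 : νb ((Q l).1.castSucc, (Q l).2) = 1 := by
    rw [hl]
    simp [hνb, finProdFinEquiv]
  have hl0 : νb ((Q l').1.castSucc, (Q l').2) = 0 := by
    rw [hl']
    simp [hνb, finProdFinEquiv]
  refine linearIndependent_of_triangular (κ := (Colex (Finset ℕ) ×ₗ ℕ) ⊕ₗ ℕᵒᵈ)
    (fun idx => match idx with
      | Sum.inl Sj => Sum.inlₗ (leadKey (Finset.univ.image fun l =>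
          νa ((ord Sj.1.1 l).1, (ord Sj.1.1 l).2.castSucc)) Sj.2)
      | Sum.inr j => Sum.inrₗ (OrderDual.toDual (j : ℕ))) ?_
  rintro (⟨⟨S, hS⟩, j⟩ | j)
  · obtain ⟨A, q, q', hne, htri⟩ := exists_leading_monomialCoord k hxya (hNa S hS) hνa_inj j.2
    refine ⟨monomialCoord k A q q', ?_, ?_⟩
    · simp only [alphaEl_eq_shiftSyzygy]
      exact hne
    · rintro (⟨⟨S', hS'⟩, j'⟩ | j') h
      · simp only [alphaEl_eq_shiftSyzygy] at h
        rcases htri _ _ (hNa S' hS') h with ⟨h1, h2⟩ | h1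
        · left
          obtain rfl := hlabels_inj S' S hS' hS h1
          obtain rfl := Fin.ext h2
          rfl
        · exact Or.inr (Sum.Lex.inl_lt_inl_iff.2 h1)
      · exact Or.inr (Sum.Lex.inl_lt_inr _ _)
  · obtain ⟨A, hne, htri⟩ := exists_bottom_monomialCoord k hxyb hNb hνb_inj hl1 hl0 j.2
    refine ⟨monomialCoord k A ((Q l).1.succ, (Q l).2) ((Q l').1.castSucc, (Q l').2), ?_, ?_⟩
    · simp only [betaEl_eq_shiftSyzygy]
      exact hne
    · rintro (⟨⟨S', hS'⟩, j'⟩ | j') h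
      · simp only [alphaEl_eq_shiftSyzygy] at h
        refine absurd (monomialCoord_shiftSyzygy_eq_zero ?_ ?_ _ _ _) h
        · rw [hl]
          intro w hw
          exact Fin.succ_ne_zero _ (Prod.ext_iff.1 hw).2
        · rw [hl']
          intro w hw
          exact Fin.succ_ne_zero _ (Prod.ext_iff.1 hw).2
      · simp only [betaEl_eq_shiftSyzygy] at h
        rcases (htri _ h).eq_or_lt with h1 | h1
        · exact Or.inl (congrArg Sum.inr (Fin.ext h1))
        · exact Or.inr (Sum.Lex.inr_lt_inr_iff.2 (OrderDual.toDual_lt_toDual.2 h1))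

end
end
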